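/- arXiv:math/9803042 — 2 statements merged into one kernel-verified Lean document; each statement's English description precedes it below -/
import Mathlib

section
/- Let G be an abelian group isomorphic to a direct product D × R, where D is a divisible abelian group (every element of D has an n-th root in D for every integer n > 0) and R is a reduced abelian group (the only divisible subgroup of R is the trivial subgroup). Then G is absolutely closed in N₂ if and only if R is absolutely closed in N₂. -/
universe u

/-- A group is nilpotent of class at most 2 (lies in `N₂`) if its commutator
subgroup is contained in its center. -/
def IsNil2 (G : Type*) [Group G] : Prop :=
  commutator G ≤ Subgroup.center G

/-- The dominion of a subgroup `B` of `A` in the variety `N₂`: the set of `a ∈ A`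
such that any two homomorphisms from `A` to a nil-2 group agreeing on `B` agree at `a`. -/
def Dominion {A : Type u} [Group A] (B : Subgroup A) : Set A :=
  {a | ∀ (C : Type u) [Group C], IsNil2 C →
    ∀ f g : A →* C, (∀ b ∈ B, f b = g b) → f a = g a}

/-- A group `B` is absolutely closed in `N₂` if for every nil-2 group `A`
containing (a copy of) `B` as a subgroup, the dominion of `B` in `A` is `B`. -/
def IsAbsolutelyClosed (B : Type u) [Group B] : Prop :=
  ∀ (A : Type u) [Group A], IsNil2 A →
    ∀ ι : B →* A, Function.Injective ι →
      Dominion ι.range = (ι.range : Set A)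

open commutatorElement
open TensorProduct

/-- Coordinates on a finitely generated abelian group. -/
lemma fg_coords (Q : Type*) [AddCommGroup Q] [AddGroup.FG Q] :
    ∃ (ι : Type) (_ : Fintype ι) (q : ι → ℕ) (e : ι → Q) (c : ∀ i, Q →+ ZMod (q i)),
      (∀ i, q i • e i = 0) ∧ (∀ i j, i ≠ j → c i (e j) = 0) ∧ (∀ i, c i (e i) = 1) ∧
      ∀ y, ∃ k : ι → ℤ, y = ∑ i, k i • e i := by
  classical
  obtain ⟨n, ι, _, p, _, ex, ⟨f⟩⟩ := AddCommGroup.equiv_free_prod_directSum_zmod Q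
  refine ⟨Fin n ⊕ ι, inferInstance, Sum.elim (fun _ => 0) (fun i => p i ^ ex i),
    Sum.elim (fun i => f.symm (Finsupp.single i 1, 0))
      (fun i => f.symm (0, DirectSum.of (fun i => ZMod (p i ^ ex i)) i 1)),
    fun i => match i with
      | .inl i => ((Finsupp.applyAddHom i).comp (AddMonoidHom.fst _ _)).comp f.toAddMonoidHom
      | .inr i => ((DFinsupp.evalAddMonoidHom i).comp (AddMonoidHom.snd _ _)).comp f.toAddMonoidHom,
    ?_, ?_, ?_, ?_⟩
  · rintro (i | i)
    · simp
    · simp only [Sum.elim_inr]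
      rw [← map_nsmul, Prod.smul_mk, ← map_nsmul]
      simp
  · rintro (i | i) (j | j) hij
    · have : i ≠ j := fun h => hij (by rw [h])
      show (f (f.symm _)).1 i = 0
      simp [this.symm]
    · show (f (f.symm _)).1 i = 0
      simp
    · show (f (f.symm _)).2 i = 0
      simp
    · have : i ≠ j := fun h => hij (by rw [h])
      show (f (f.symm _)).2 i = 0
      simp only [AddEquiv.apply_symm_apply]
      exact DirectSum.of_eq_of_ne _ _ _ this
  · rintro (i | i)
    · show (f (f.symm _)).1 i = (1 : ℤ)
      simp
    · show (f (f.symm _)).2 i = _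
      simp only [AddEquiv.apply_symm_apply]
      exact DirectSum.of_eq_same _ _
  · intro y
    refine ⟨Sum.elim (fun i => (f y).1 i) (fun i => ((f y).2 i).cast), ?_⟩
    apply f.injective
    rw [Fintype.sum_sum_type, map_add, map_sum, map_sum]
    simp only [Sum.elim_inl, Sum.elim_inr, map_zsmul, AddEquiv.apply_symm_apply]
    ext i
    · simp [Prod.fst_sum]
    · simp only [Prod.snd_add, Prod.snd_sum, Prod.smul_snd, smul_zero, Finset.sum_const_zero,
        zero_add]
      rw [DirectSum.sum_apply, Finset.sum_eq_single i]
      · rw [DirectSum.smul_apply, DirectSum.of_eq_same]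
        simp
      · intro b _ hb
        rw [DirectSum.smul_apply, DirectSum.of_eq_of_ne _ _ _ hb.symm, smul_zero]
      · simp

lemma one_tmul_eq_zero {M : Type*} [AddCommGroup M] (q : ℕ) (m : M)
    (h : (1 : ZMod q) ⊗ₜ[ℤ] m = 0) : ∃ m', m = q • m' := by
  let S : AddSubgroup M := (nsmulAddMonoidHom (α := M) q).range
  let g : ZMod q →+ (M →+ M ⧸ S) := ZMod.lift q ⟨zmultiplesHom _ (QuotientAddGroup.mk' S), by
    ext x
    simp only [zmultiplesHom_apply, AddMonoidHom.zero_apply]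
    rw [natCast_zsmul, AddMonoidHom.nsmul_apply, ← map_nsmul]
    exact (QuotientAddGroup.eq_zero_iff _).2 ⟨x, rfl⟩⟩
  let L : ZMod q ⊗[ℤ] M →ₗ[ℤ] M ⧸ S := TensorProduct.lift
    (LinearMap.mk₂ ℤ (fun a b => g a b) (by simp) (by intros; rw [map_zsmul]; rfl) (by simp)
      (by intros; simp))
  have h1 : L ((1 : ZMod q) ⊗ₜ[ℤ] m) = 0 := by rw [h, map_zero]
  have h2 : g 1 m = 0 := h1
  have h3 : g 1 = QuotientAddGroup.mk' S := by
    have := ZMod.lift_coe q ⟨zmultiplesHom _ (QuotientAddGroup.mk' S), by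
      ext x
      simp only [zmultiplesHom_apply, AddMonoidHom.zero_apply]
      rw [natCast_zsmul, AddMonoidHom.nsmul_apply, ← map_nsmul]
      exact (QuotientAddGroup.eq_zero_iff _).2 ⟨x, rfl⟩⟩ 1
    simpa using this
  rw [h3] at h2
  obtain ⟨m', hm⟩ := (QuotientAddGroup.eq_zero_iff _).1 h2
  exact ⟨m', hm.symm⟩

lemma ker_fg {Q N M T : Type*} [AddCommGroup Q] [AddCommGroup N] [AddCommGroup M]
    [AddCommGroup T] [AddGroup.FG Q] (φ : N →ₗ[ℤ] M) (β : Q →ₗ[ℤ] N →ₗ[ℤ] T)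
    (h : ∀ y n m (q : ℕ), q • y = 0 → φ n = q • m → β y n = 0)
    (z : Q ⊗[ℤ] N) (hz : φ.lTensor Q z = 0) : TensorProduct.lift β z = 0 := by
  classical
  obtain ⟨ι, _, q, e, c, h1, h2, h3, h4⟩ := fg_coords Q
  have hz' : ∃ n : ι → N, z = ∑ i, e i ⊗ₜ[ℤ] n i := by
    clear hz
    induction z with
    | zero => exact ⟨0, by simp⟩
    | tmul y n =>
      obtain ⟨k, hk⟩ := h4 y
      refine ⟨fun i => k i • n, ?_⟩
      rw [hk, TensorProduct.sum_tmul]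
      simp [TensorProduct.smul_tmul]
    | add a b ha hb =>
      obtain ⟨n1, rfl⟩ := ha
      obtain ⟨n2, rfl⟩ := hb
      exact ⟨n1 + n2, by simp [TensorProduct.tmul_add, Finset.sum_add_distrib]⟩
  obtain ⟨n, rfl⟩ := hz'
  rw [map_sum]
  apply Finset.sum_eq_zero
  intro i _
  rw [TensorProduct.lift.tmul]
  have h5 : ((c i).toIntLinearMap.rTensor M) (φ.lTensor Q (∑ i, e i ⊗ₜ[ℤ] n i)) = 0 := by
    rw [hz, map_zero]
  rw [map_sum, map_sum, Finset.sum_eq_single i] at h5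
  · simp only [LinearMap.lTensor_tmul, LinearMap.rTensor_tmul, AddMonoidHom.coe_toIntLinearMap,
      h3] at h5
    obtain ⟨m, hm⟩ := one_tmul_eq_zero _ _ h5
    exact h _ _ m _ (h1 i) hm
  · intro j _ hj
    simp [h2 i j hj.symm]
  · simp

lemma ker_gen {Q N M T : Type*} [AddCommGroup Q] [AddCommGroup N] [AddCommGroup M]
    [AddCommGroup T] (φ : N →ₗ[ℤ] M) (β : Q →ₗ[ℤ] N →ₗ[ℤ] T)
    (h : ∀ y n m (q : ℕ), q • y = 0 → φ n = q • m → β y n = 0)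
    (z : Q ⊗[ℤ] N) (hz : φ.lTensor Q z = 0) : TensorProduct.lift β z = 0 := by
  obtain ⟨P, hP, z', rfl⟩ := Submodule.exists_fg_le_eq_rTensor_subtype z
  have hz2 : P.subtype.rTensor M (φ.lTensor P z') = 0 := by
    rw [← hz, ← LinearMap.comp_apply, ← LinearMap.comp_apply, LinearMap.rTensor_comp_lTensor,
      LinearMap.lTensor_comp_rTensor]
  obtain ⟨P', hPP, hfg, h0⟩ := TensorProduct.eq_zero_of_fg_of_subtype_eq_zero hP hz2
  have : AddGroup.FG P' := Module.Finite.iff_addGroup_fg.mp (Module.Finite.iff_fg.mpr hfg)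
  have key := ker_fg (Q := P') φ (β.comp P'.subtype)
    (fun y n m q hy hn => h _ n m q (by rw [← map_nsmul, hy, map_zero]) hn)
    ((Submodule.inclusion hPP).rTensor N z') (by
      rw [← h0, ← LinearMap.comp_apply, ← LinearMap.comp_apply, LinearMap.rTensor_comp_lTensor,
      LinearMap.lTensor_comp_rTensor])
  rw [← key, ← LinearMap.comp_apply, ← LinearMap.comp_apply]
  congr 1
  ext
  simp

/-- Extension of bilinear maps into `ℚ/ℤ`. -/
lemma bilin_ext {Q N M : Type*} [AddCommGroup Q] [AddCommGroup N] [AddCommGroup M]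
    (φ : N →+ M) (β : Q →+ N →+ AddCircle (1 : ℚ))
    (h : ∀ y n m (q : ℕ), q • y = 0 → φ n = q • m → β y n = 0) :
    ∃ γ : Q →+ M →+ AddCircle (1 : ℚ), ∀ y n, γ y (φ n) = β y n := by
  let β' : Q →ₗ[ℤ] N →ₗ[ℤ] AddCircle (1 : ℚ) := LinearMap.mk₂ ℤ (fun a b => β a b)
    (by simp) (by intros; simp) (by simp) (by intros; simp)
  let L := φ.toIntLinearMap.lTensor Q
  let F := TensorProduct.lift β'
  have hle : LinearMap.ker L ≤ LinearMap.ker F := fun z hz => ker_gen _ β' h z hz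
  let j := (LinearMap.ker L).liftQ L le_rfl
  have hj : Function.Injective j := by
    rw [← LinearMap.ker_eq_bot]
    exact Submodule.ker_liftQ_eq_bot _ _ _ le_rfl
  obtain ⟨G, hG⟩ := CharacterModule.dual_surjective_of_injective j hj
    ((LinearMap.ker L).liftQ F hle).toAddMonoidHom
  let G' : Q ⊗[ℤ] M →+ AddCircle (1 : ℚ) := G
  refine ⟨AddMonoidHom.mk' (fun y => AddMonoidHom.mk' (fun m => G' (y ⊗ₜ m)) ?_) ?_, ?_⟩
  · intro a b; simp [TensorProduct.tmul_add]
  · intro a b; ext; simp [TensorProduct.add_tmul]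
  · intro y n
    exact DFunLike.congr_fun hG (Submodule.Quotient.mk (y ⊗ₜ[ℤ] n))

/-- Multiplicative form of `bilin_ext`. -/
lemma bilin_ext_mul {Q N M : Type*} [CommGroup Q] [CommGroup N] [CommGroup M]
    (φ : N →* M) (β : Q →* N →* Multiplicative (AddCircle (1 : ℚ)))
    (h : ∀ y n m (q : ℕ), y ^ q = 1 → φ n = m ^ q → β y n = 1) :
    ∃ γ : Q →* M →* Multiplicative (AddCircle (1 : ℚ)), ∀ y n, γ y (φ n) = β y n := by
  let β' : Additive Q →+ Additive N →+ AddCircle (1 : ℚ) :=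
    AddMonoidHom.mk' (fun y => AddMonoidHom.mk' (fun n => (β y.toMul n.toMul).toAdd)
      (by intros; simp)) (by intros; ext; simp)
  obtain ⟨γ, hγ⟩ := bilin_ext (Q := Additive Q) (N := Additive N) (M := Additive M)
    φ.toAdditive β' (fun y n m q hy hn => h y.toMul n.toMul m.toMul q hy hn)
  refine ⟨MonoidHom.mk' (fun y => MonoidHom.mk'
    (fun m => Multiplicative.ofAdd (γ (Additive.ofMul y) (Additive.ofMul m)))
      (by intros; simp)) (by intros; ext; simp), ?_⟩
  intro y n
  exact hγ (Additive.ofMul y) (Additive.ofMul n)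

lemma exists_char {N : Type*} [CommGroup N] (B : Subgroup N) (a : N) (ha : a ∉ B) :
    ∃ χ : N →* Multiplicative (AddCircle (1 : ℚ)), (∀ b ∈ B, χ b = 1) ∧ χ a ≠ 1 := by
  have hne : Additive.ofMul (QuotientGroup.mk' B a) ≠ 0 := by
    intro h
    exact ha ((QuotientGroup.eq_one_iff a).1 h)
  obtain ⟨c, hc⟩ := CharacterModule.exists_character_apply_ne_zero_of_ne_zero hne
  let c' : Additive (N ⧸ B) →+ AddCircle (1 : ℚ) := c
  refine ⟨(AddMonoidHom.toMultiplicativeRight c').comp (QuotientGroup.mk' B), ?_, ?_⟩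
  · intro b hb
    have : QuotientGroup.mk' B b = 1 := (QuotientGroup.eq_one_iff b).2 hb
    rw [MonoidHom.comp_apply, this, map_one]
  · intro h
    exact hc h

section Nil2

lemma isNil2_iff {A : Type*} [Group A] :
    IsNil2 A ↔ ∀ x y z : A, z * ⁅x, y⁆ = ⁅x, y⁆ * z := by
  unfold IsNil2
  rw [commutator_def, Subgroup.commutator_le]
  simp [Subgroup.mem_center_iff]

lemma IsNil2.of_surjective {A C : Type*} [Group A] [Group C] (hA : IsNil2 A) (f : A →* C)
    (hf : Function.Surjective f) : IsNil2 C := by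
  rw [isNil2_iff] at *
  intro x y z
  obtain ⟨x, rfl⟩ := hf x
  obtain ⟨y, rfl⟩ := hf y
  obtain ⟨z, rfl⟩ := hf z
  rw [← map_commutatorElement, ← map_mul, ← map_mul, hA]

variable {A : Type*} [Group A]

lemma comm_mul_left (hA : IsNil2 A) (x y z : A) : ⁅x * y, z⁆ = ⁅x, z⁆ * ⁅y, z⁆ := by
  rw [isNil2_iff] at hA
  rw [commutatorElement_mul_left_eq_conj_mul, hA y z x, mul_inv_cancel_right, hA]

lemma comm_mul_right (hA : IsNil2 A) (x y z : A) : ⁅x, y * z⁆ = ⁅x, y⁆ * ⁅x, z⁆ := by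
  rw [isNil2_iff] at hA
  rw [commutatorElement_mul_right_eq_mul_conj, mul_assoc, mul_assoc, ← mul_assoc y, hA x z y]
  simp

lemma comm_pow_left (hA : IsNil2 A) (x z : A) (q : ℕ) : ⁅x ^ q, z⁆ = ⁅x, z⁆ ^ q := by
  induction q with
  | zero => simp
  | succ q ih => rw [pow_succ, comm_mul_left hA, ih, pow_succ]

lemma comm_pow_right (hA : IsNil2 A) (x z : A) (q : ℕ) : ⁅x, z ^ q⁆ = ⁅x, z⁆ ^ q := by
  induction q with
  | zero => simp
  | succ q ih => rw [pow_succ, comm_mul_right hA, ih, pow_succ]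

lemma comm_mem_left (hA : IsNil2 A) {c : A} (hc : c ∈ commutator A) (z : A) : ⁅c, z⁆ = 1 := by
  rw [commutatorElement_eq_one_iff_mul_comm]
  exact (Subgroup.mem_center_iff.1 (hA hc) z).symm

lemma comm_mem_right (hA : IsNil2 A) {c : A} (hc : c ∈ commutator A) (z : A) : ⁅z, c⁆ = 1 := by
  rw [commutatorElement_eq_one_iff_mul_comm]
  exact (Subgroup.mem_center_iff.1 (hA hc) z)

lemma of_eq_iff {x y : A} : Abelianization.of x = Abelianization.of y ↔
    ∃ c ∈ commutator A, x = y * c := by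
  rw [Abelianization.of]
  constructor
  · intro h
    exact ⟨y⁻¹ * x, QuotientGroup.eq.1 h.symm, by simp⟩
  · rintro ⟨c, hc, rfl⟩
    exact (QuotientGroup.eq.2 (by simpa using hc)).symm

lemma of_comm_eq_one {c : A} (hc : c ∈ commutator A) : Abelianization.of c = 1 := by
  rw [← map_one Abelianization.of, of_eq_iff]
  exact ⟨c, hc, by simp⟩

lemma comm_mem (x y : A) : ⁅x, y⁆ ∈ commutator A :=
  Subgroup.commutator_mem_commutator (Subgroup.mem_top x) (Subgroup.mem_top y)

lemma mem_sup_comm {K : Subgroup A} {z : A} :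
    z ∈ K ⊔ commutator A ↔ ∃ k ∈ K, Abelianization.of z = Abelianization.of k := by
  rw [Subgroup.mem_sup_of_normal_right]
  constructor
  · rintro ⟨k, hk, c, hc, rfl⟩
    exact ⟨k, hk, of_eq_iff.2 ⟨c, hc, rfl⟩⟩
  · rintro ⟨k, hk, h⟩
    obtain ⟨c, hc, rfl⟩ := of_eq_iff.1 h
    exact ⟨k, hk, c, hc, rfl⟩

/-- Commutators only depend on the arguments modulo the derived subgroup. -/
lemma comm_congr (hA : IsNil2 A) {x x' y y' : A} (hx : Abelianization.of x = Abelianization.of x')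
    (hy : Abelianization.of y = Abelianization.of y') : ⁅x, y⁆ = ⁅x', y'⁆ := by
  obtain ⟨c, hc, rfl⟩ := of_eq_iff.1 hx
  obtain ⟨d, hd, rfl⟩ := of_eq_iff.1 hy
  rw [comm_mul_left hA, comm_mem_left hA hc, comm_mul_right hA, comm_mem_right hA hd]
  simp

lemma sup_comm_commute (hA : IsNil2 A) {B : Subgroup A} (hB : ∀ x ∈ B, ∀ y ∈ B, x * y = y * x)
    {x y : A} (hx : x ∈ B ⊔ commutator A) (hy : y ∈ B ⊔ commutator A) : ⁅x, y⁆ = 1 := by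
  obtain ⟨b, hb, h1⟩ := mem_sup_comm.1 hx
  obtain ⟨d, hd, h2⟩ := mem_sup_comm.1 hy
  rw [comm_congr hA h1 h2, commutatorElement_eq_one_iff_mul_comm]
  exact hB b hb d hd

end Nil2

/-- Easy half of the description of dominions. -/
lemma pow_mem_dominion {A : Type u} [Group A] (B : Subgroup A) (x y : A) (q : ℕ)
    (hx : x ^ q ∈ B ⊔ commutator A) (hy : y ^ q ∈ B ⊔ commutator A) :
    ⁅x, y⁆ ^ q ∈ Dominion B := by
  intro C _ hC f g hfg
  have key : ∀ z ∈ B ⊔ commutator A, Abelianization.of (f z) = Abelianization.of (g z) := by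
    intro z hz
    obtain ⟨b, hb, h⟩ := mem_sup_comm.1 hz
    have h1 := congrArg (Abelianization.map f) h
    have h2 := congrArg (Abelianization.map g) h
    rw [Abelianization.map_of, Abelianization.map_of] at h1 h2
    rw [h1, h2, hfg b hb]
  rw [map_pow, map_pow, map_commutatorElement, map_commutatorElement, ← comm_pow_left hC,
    ← map_pow, comm_congr hC (key _ hx) rfl, map_pow, comm_pow_left hC, ← comm_pow_right hC,
    ← map_pow, comm_congr hC rfl (key _ hy), map_pow, comm_pow_right hC]

/-- A central extension of `A × A` defined by a bilinear cocycle. -/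
@[ext] structure Tri {A M : Type*} [Group A] [CommGroup M] (β : A →* A →* M) where
  x : A
  y : A
  t : M

namespace Tri

variable {A M : Type*} [Group A] [CommGroup M] {β : A →* A →* M}

instance : Mul (Tri β) := ⟨fun g h => ⟨g.x * h.x, g.y * h.y, g.t * h.t * β g.y h.x⟩⟩
instance : One (Tri β) := ⟨⟨1, 1, 1⟩⟩
instance : Inv (Tri β) := ⟨fun g => ⟨g.x⁻¹, g.y⁻¹, g.t⁻¹ * β g.y g.x⟩⟩

@[simp] lemma mul_x (g h : Tri β) : (g * h).x = g.x * h.x := rfl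
@[simp] lemma mul_y (g h : Tri β) : (g * h).y = g.y * h.y := rfl
@[simp] lemma mul_t (g h : Tri β) : (g * h).t = g.t * h.t * β g.y h.x := rfl
@[simp] lemma one_x : (1 : Tri β).x = 1 := rfl
@[simp] lemma one_y : (1 : Tri β).y = 1 := rfl
@[simp] lemma one_t : (1 : Tri β).t = 1 := rfl
@[simp] lemma inv_x (g : Tri β) : (g⁻¹).x = g.x⁻¹ := rfl
@[simp] lemma inv_y (g : Tri β) : (g⁻¹).y = g.y⁻¹ := rfl
@[simp] lemma inv_t (g : Tri β) : (g⁻¹).t = g.t⁻¹ * β g.y g.x := rfl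

instance : Group (Tri β) := Group.ofLeftAxioms
  (by
    intro a b c
    ext
    · simp [mul_assoc]
    · simp [mul_assoc]
    · simp only [mul_t, mul_x, mul_y, map_mul, MonoidHom.mul_apply]
      simp only [mul_assoc, mul_comm, mul_left_comm])
  (by intro a; ext <;> simp)
  (by intro a; ext <;> simp)

lemma isNil2 (hA : IsNil2 A) : IsNil2 (Tri β) := by
  rw [isNil2_iff]
  intro g h k
  have hx : (⁅g, h⁆ : Tri β).x = ⁅g.x, h.x⁆ := by simp [commutatorElement_def]
  have hy : (⁅g, h⁆ : Tri β).y = ⁅g.y, h.y⁆ := by simp [commutatorElement_def]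
  have hA' := isNil2_iff.1 hA
  ext
  · rw [mul_x, mul_x, hx, hA']
  · rw [mul_y, mul_y, hy, hA']
  · rw [mul_t, mul_t, hx, hy]
    have h1 : β k.y ⁅g.x, h.x⁆ = 1 := by
      rw [map_commutatorElement, commutatorElement_eq_one_iff_mul_comm, mul_comm]
    have h2 : β ⁅g.y, h.y⁆ = 1 := by
      rw [map_commutatorElement, commutatorElement_eq_one_iff_mul_comm, mul_comm]
    rw [h1, h2, mul_comm k.t]
    simp

/-- The amalgamating subgroup. -/
def S (β : A →* A →* M) (N : Subgroup A) (χ : N →* M)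
    (h1 : ∀ y, ∀ n ∈ N, β y n = 1) : Subgroup (Tri β) where
  carrier := {g | Abelianization.of g.x * Abelianization.of g.y = 1 ∧
    ∃ h : g.x ∈ N, g.t = (χ ⟨g.x, h⟩)⁻¹}
  one_mem' := ⟨by simp, N.one_mem, by
    have : (⟨(1 : Tri β).x, N.one_mem⟩ : N) = 1 := rfl
    rw [this, map_one]; simp⟩
  mul_mem' := by
    rintro a b ⟨ha, ha', ha''⟩ ⟨hb, hb', hb''⟩
    refine ⟨?_, N.mul_mem ha' hb', ?_⟩
    · rw [mul_x, mul_y, map_mul, map_mul, mul_mul_mul_comm, ha, hb, one_mul]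
    · have : (⟨(a * b).x, N.mul_mem ha' hb'⟩ : N) = ⟨a.x, ha'⟩ * ⟨b.x, hb'⟩ := rfl
      rw [this, map_mul, mul_t, h1 _ _ hb', ha'', hb'', mul_one, mul_inv]
  inv_mem' := by
    rintro a ⟨ha, ha', ha''⟩
    refine ⟨?_, N.inv_mem ha', ?_⟩
    · rw [inv_x, inv_y, map_inv, map_inv, ← mul_inv, ha, inv_one]
    · have : (⟨(a⁻¹).x, N.inv_mem ha'⟩ : N) = ⟨a.x, ha'⟩⁻¹ := rfl
      rw [this, map_inv, inv_t, h1 _ _ ha', ha'', mul_one]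

lemma S_normal {N : Subgroup A} {χ : N →* M}
    (h1 : ∀ y, ∀ n ∈ N, β y n = 1) (hN : commutator A ≤ N)
    (h2 : ∀ (n : N) (x : A), β n x = χ ⟨⁅(n : A), x⁆, hN (comm_mem _ _)⟩) :
    (S β N χ h1).Normal := by
  refine ⟨?_⟩
  rintro s ⟨hs, hs', hs''⟩ g
  have hx : (g * s * g⁻¹).x = ⁅s.x, g.x⁆⁻¹ * s.x := by
    simp [commutatorElement_def, mul_assoc]
  have hmem : ⁅s.x, g.x⁆⁻¹ * s.x ∈ N := N.mul_mem (N.inv_mem (hN (comm_mem _ _))) hs'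
  refine ⟨?_, hx ▸ hmem, ?_⟩
  · simp only [mul_x, mul_y, inv_x, inv_y, map_mul, map_inv]
    rw [mul_inv_cancel_comm, mul_inv_cancel_comm, hs]
  · have e : (⟨(g * s * g⁻¹).x, hx ▸ hmem⟩ : N) =
        (⟨⁅s.x, g.x⁆, hN (comm_mem _ _)⟩ : N)⁻¹ * ⟨s.x, hs'⟩ := Subtype.ext hx
    have hy : β s.y = (β s.x)⁻¹ := by
      have := congrArg (Abelianization.lift β) hs
      rw [map_mul, Abelianization.lift_apply_of, Abelianization.lift_apply_of, map_one] at this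
      exact eq_inv_of_mul_eq_one_right this
    rw [e, map_mul, map_inv, ← h2 ⟨s.x, hs'⟩ g.x]
    simp only [mul_t, mul_y, inv_x, inv_t, map_mul, MonoidHom.mul_apply, map_inv, h1 _ _ hs', hs'',
      hy, MonoidHom.inv_apply]
    simp only [mul_inv, inv_inv, mul_one]
    generalize χ _ = a
    generalize β s.x g.x = b
    generalize β g.y g.x = c
    rw [show g.t * a⁻¹ * (g.t⁻¹ * c) * (c⁻¹ * b) = (g.t * g.t⁻¹) * (c * c⁻¹) * (b * a⁻¹) by
      simp only [mul_assoc, mul_comm, mul_left_comm]]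
    simp

end Tri

lemma dominion_le {A : Type u} [Group A] (hA : IsNil2 A) (B : Subgroup A)
    (hB : ∀ x ∈ B, ∀ y ∈ B, x * y = y * x)
    (hq : ∀ (x y : A) (q : ℕ), x ^ q ∈ B ⊔ commutator A → y ^ q ∈ B ⊔ commutator A →
      ⁅x, y⁆ ^ q ∈ B) : Dominion B ⊆ B := by
  intro a ha
  obtain ⟨N, hNdef⟩ : ∃ N, N = B ⊔ commutator A := ⟨_, rfl⟩
  have hN : commutator A ≤ N := hNdef ▸ le_sup_right
  have hBN : B ≤ N := hNdef ▸ le_sup_left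
  have hNn : N.Normal := by
    refine ⟨fun n hn g => ?_⟩
    have : g * n * g⁻¹ = ⁅g, n⁆ * n := by simp [commutatorElement_def]
    rw [this]
    exact N.mul_mem (hN (comm_mem _ _)) hn
  have hNc : ∀ {x y}, x ∈ N → y ∈ N → ⁅x, y⁆ = 1 := by
    intro x y hx hy
    rw [hNdef] at hx hy
    exact sup_comm_commute hA hB hx hy
  have haN : a ∈ N := by
    have := ha (A ⧸ N) (hA.of_surjective (QuotientGroup.mk' N) (QuotientGroup.mk'_surjective N))
      (QuotientGroup.mk' N) 1 (fun b hb => (QuotientGroup.eq_one_iff b).2 (hBN hb))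
    exact (QuotientGroup.eq_one_iff a).1 this
  by_contra haB
  letI : CommGroup N := { (inferInstance : Group N) with
    mul_comm := fun x y => Subtype.ext
      (commutatorElement_eq_one_iff_mul_comm.1 (hNc x.2 y.2)) }
  letI : CommGroup (A ⧸ N) := { (inferInstance : Group (A ⧸ N)) with
    mul_comm := (Subgroup.Normal.quotient_commutative_iff_commutator_le.2 hN).is_comm.comm }
  obtain ⟨χ, hχ, hχa⟩ := exists_char (B.subgroupOf N) ⟨a, haN⟩
    (fun h => haB (Subgroup.mem_subgroupOf.1 h))
  let β0 : A ⧸ N →* N →* Multiplicative (AddCircle (1 : ℚ)) :=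
    QuotientGroup.lift N (MonoidHom.mk' (fun y => MonoidHom.mk'
      (fun n => χ ⟨⁅(n : A), y⁆, hN (comm_mem _ _)⟩)
      (by
        intro n m
        rw [← map_mul]
        exact congrArg χ (Subtype.ext (comm_mul_left hA _ _ _))))
      (by
        intro y z
        ext n
        simp only [MonoidHom.mk'_apply, MonoidHom.mul_apply]
        rw [← map_mul]
        exact congrArg _ (congrArg χ (Subtype.ext (comm_mul_right hA _ _ _)))))
      (by
        intro y hy
        ext n
        simp only [MonoidHom.mk'_apply, MonoidHom.one_apply]
        rw [← map_one χ]
        exact congrArg _ (congrArg χ (Subtype.ext (hNc n.2 hy))))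
  have hβ0 : ∀ (y : A) (n : N), β0 (QuotientGroup.mk' N y) n =
      χ ⟨⁅(n : A), y⁆, hN (comm_mem _ _)⟩ := fun y n => rfl
  obtain ⟨γ, hγ⟩ := bilin_ext_mul ((Abelianization.of (G := A)).comp N.subtype) β0 (by
    intro y n m q hy hn
    obtain ⟨y, rfl⟩ := QuotientGroup.mk'_surjective N y
    obtain ⟨m, rfl⟩ := QuotientGroup.mk_surjective m
    have hn' : Abelianization.of (n : A) = Abelianization.of (m ^ q) := hn
    rw [← map_pow] at hy
    have hy' : y ^ q ∈ N := (QuotientGroup.eq_one_iff _).1 hy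
    have hm' : m ^ q ∈ N := by
      obtain ⟨c, hc, h⟩ := of_eq_iff.1 hn'.symm
      rw [h]
      exact N.mul_mem n.2 (hN hc)
    rw [hβ0]
    apply hχ
    rw [Subgroup.mem_subgroupOf]
    show ⁅(n : A), y⁆ ∈ B
    rw [comm_congr hA hn' rfl, comm_pow_left hA]
    exact hq m y q (hNdef ▸ hm') (hNdef ▸ hy'))
  let β : A →* A →* Multiplicative (AddCircle (1 : ℚ)) :=
    MonoidHom.mk' (fun x => MonoidHom.mk'
      (fun y => γ (QuotientGroup.mk' N y) (Abelianization.of x)) (by intros; simp))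
      (by intros; ext; simp)
  have h1 : ∀ y, ∀ n ∈ N, β y n = 1 := by
    intro y n hn
    show γ (QuotientGroup.mk' N n) (Abelianization.of y) = 1
    have : QuotientGroup.mk' N n = 1 := (QuotientGroup.eq_one_iff n).2 hn
    rw [this, map_one, MonoidHom.one_apply]
  have h2 : ∀ (n : N) (x : A), β n x = χ ⟨⁅(n : A), x⁆, hN (comm_mem _ _)⟩ :=
    fun n x => hγ (QuotientGroup.mk' N x) n
  have hS := Tri.S_normal h1 hN h2
  let S := Tri.S β N χ h1
  let f0 : A →* Tri β := MonoidHom.mk' (fun x => ⟨x, 1, 1⟩) (by intros; ext <;> simp)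
  let g0 : A →* Tri β := MonoidHom.mk' (fun x => ⟨1, x, 1⟩) (by intros; ext <;> simp)
  have hfg : ∀ n (hn : n ∈ N), (f0 n)⁻¹ * g0 n ∈ S ↔ χ ⟨n, hn⟩ = 1 := by
    intro n hn
    have hx : ((f0 n)⁻¹ * g0 n).x = n⁻¹ := by simp [f0, g0]
    have hy : ((f0 n)⁻¹ * g0 n).y = n := by simp [f0, g0]
    have ht : ((f0 n)⁻¹ * g0 n).t = 1 := by simp [f0, g0]
    constructor
    · rintro ⟨_, h, h'⟩
      have e : (⟨((f0 n)⁻¹ * g0 n).x, h⟩ : N) = ⟨n, hn⟩⁻¹ := Subtype.ext hx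
      rw [e, map_inv, ht, inv_inv] at h'
      exact h'.symm
    · intro h
      have hm : ((f0 n)⁻¹ * g0 n).x ∈ N := hx ▸ N.inv_mem hn
      refine ⟨by rw [hx, hy, map_inv, inv_mul_cancel], hm, ?_⟩
      have e : (⟨((f0 n)⁻¹ * g0 n).x, hm⟩ : N) = ⟨n, hn⟩⁻¹ := Subtype.ext hx
      rw [e, map_inv, ht, inv_inv, h]
  have := ha (Tri β ⧸ S) ((Tri.isNil2 hA).of_surjective (QuotientGroup.mk' S)
    (QuotientGroup.mk'_surjective S)) ((QuotientGroup.mk' S).comp f0)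
    ((QuotientGroup.mk' S).comp g0) (fun b hb => QuotientGroup.eq.2
      ((hfg b (hBN hb)).2 (hχ _ (Subgroup.mem_subgroupOf.2 hb))))
  exact hχa ((hfg a haN).1 (QuotientGroup.eq.1 this))

lemma subset_dominion {A : Type u} [Group A] (B : Subgroup A) : (B : Set A) ⊆ Dominion B :=
  fun b hb _ _ _ _ _ h => h b hb

lemma closed_of_reduced {G D R : Type u}
    [CommGroup G] [CommGroup D] [CommGroup R] (iso : G ≃* D × R)
    (hD : ∀ (d : D) (n : ℕ), 0 < n → ∃ e : D, e ^ n = d)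
    (h : IsAbsolutelyClosed R) : IsAbsolutelyClosed G := by
  intro A _ hA ι hι
  refine Set.Subset.antisymm ?_ (subset_dominion _)
  have hB : ∀ x ∈ ι.range, ∀ y ∈ ι.range, x * y = y * x := by
    rintro _ ⟨x, rfl⟩ _ ⟨y, rfl⟩
    rw [← map_mul, mul_comm, map_mul]
  apply dominion_le hA _ hB
  intro x y q hx hy
  rcases Nat.eq_zero_or_pos q with rfl | hq
  · rw [pow_zero]; exact ι.range.one_mem
  let ρ : R →* A := (ι.comp iso.symm.toMonoidHom).comp (MonoidHom.inr D R)
  let δ : D →* A := (ι.comp iso.symm.toMonoidHom).comp (MonoidHom.inl D R)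
  have hρ : Function.Injective ρ := by
    intro a b hab
    have := iso.symm.injective (hι hab)
    exact (Prod.ext_iff.1 this).2
  have hρle : ρ.range ≤ ι.range := by
    rintro _ ⟨r, rfl⟩
    exact ⟨_, rfl⟩
  have hδ : ∀ d, δ d ∈ ι.range := fun d => ⟨_, rfl⟩
  have key : ∀ z : A, z ^ q ∈ ι.range ⊔ commutator A →
      ∃ z' e, z = z' * δ e ∧ z' ^ q ∈ ρ.range ⊔ commutator A := by
    intro z hz
    obtain ⟨_, ⟨g, rfl⟩, hg⟩ := mem_sup_comm.1 hz
    obtain ⟨e, he⟩ := hD (iso g).1 q hq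
    refine ⟨z * (δ e)⁻¹, e, by simp, mem_sup_comm.2 ⟨ρ (iso g).2, ⟨_, rfl⟩, ?_⟩⟩
    have hdec : ι g = ρ (iso g).2 * δ e ^ q := by
      rw [← map_pow, he]
      show ι g = ι (iso.symm (1, (iso g).2)) * ι (iso.symm ((iso g).1, 1))
      rw [← map_mul, ← map_mul]
      simp
    rw [map_pow, map_mul, mul_pow, ← map_pow, hg, hdec]
    simp
  obtain ⟨x', e, rfl, hx'⟩ := key x hx
  obtain ⟨y', f, rfl, hy'⟩ := key y hy
  have hle : ρ.range ⊔ commutator A ≤ ι.range ⊔ commutator A := sup_le_sup_right hρle _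
  have hδ' : ∀ d, δ d ∈ ι.range ⊔ commutator A := fun d => Subgroup.mem_sup_left (hδ d)
  have e1 : ⁅x' * δ e, y' * δ f⁆ ^ q = ⁅x', y'⁆ ^ q := by
    rw [← comm_pow_right hA, comm_mul_left hA, sup_comm_commute hA hB (hδ' e) hy, mul_one,
      comm_pow_right hA, ← comm_pow_left hA, comm_mul_right hA,
      sup_comm_commute hA hB (hle hx') (hδ' f), mul_one, comm_pow_left hA]
  rw [e1]
  have := pow_mem_dominion ρ.range x' y' q hx' hy'
  rw [h A hA ρ hρ] at this
  exact hρle this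

lemma reduced_of_closed {G D R : Type u}
    [CommGroup G] [CommGroup D] [CommGroup R] (iso : G ≃* D × R)
    (h : IsAbsolutelyClosed G) : IsAbsolutelyClosed R := by
  intro A _ hA ι hι
  refine Set.Subset.antisymm ?_ (subset_dominion _)
  intro a ha
  have hDA : IsNil2 (D × A) := by
    rw [isNil2_iff] at *
    intro x y z
    ext
    · exact mul_comm _ _
    · exact hA _ _ _
  let κ : G →* D × A := (MonoidHom.prodMap (MonoidHom.id D) ι).comp iso.toMonoidHom
  have hκ : Function.Injective κ :=
    (Function.Injective.prodMap Function.injective_id hι).comp iso.injective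
  have hmem : ((1, a) : D × A) ∈ Dominion κ.range := by
    intro C _ hC f g hfg
    refine ha C hC (f.comp (MonoidHom.inr D A)) (g.comp (MonoidHom.inr D A)) ?_
    rintro _ ⟨r, rfl⟩
    refine hfg _ ⟨iso.symm (1, r), ?_⟩
    simp [κ]
  rw [h _ hDA κ hκ] at hmem
  obtain ⟨g, hg⟩ := hmem
  exact ⟨(iso g).2, (Prod.ext_iff.1 hg).2⟩

/-- An abelian group isomorphic to `D × R` with `D` divisible and `R` reduced is
absolutely closed in `N₂` iff its reduced part `R` is. -/
theorem absolutelyClosed_iff_reduced_part {G D R : Type u}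
    [CommGroup G] [CommGroup D] [CommGroup R] (iso : G ≃* D × R)
    (hD : ∀ (d : D) (n : ℕ), 0 < n → ∃ e : D, e ^ n = d)
    (hR : ∀ S : Subgroup R, (∀ s ∈ S, ∀ n : ℕ, 0 < n → ∃ t ∈ S, t ^ n = s) → S = ⊥) :
    IsAbsolutelyClosed G ↔ IsAbsolutelyClosed R := by
  exact ⟨reduced_of_closed iso, closed_of_reduced iso hD⟩
end

section
/- Let π be a set of primes and let G be a group of nilpotency class at most 2 that is π-divisible (every element of G has a p-th root in G for every prime p ∈ π). Then G is absolutely closed in N₂ if and only if for all x, y ∈ G, every prime q ∉ π, and every integer α ≥ 1, with n = q^α at least one of the following holds: (2.10) there exist integers a, b, c and elements g₁, g₂ ∈ G such that g₁^n ≡ x^a y^b (mod [G,G]), g₂^n ≡ x^b y^c (mod [G,G]), and [g₁,x][g₂,y] ≠ e; or (2.11) there exist integers a, b, c and elements g₁, g₂ ∈ G such that g₁^n ≡ x^a y^b (mod [G,G]) and g₂^n ≡ x^{b+1} y^c (mod [G,G]). -/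
universe u

/-- Condition (2.10): there exist integers `a`, `b`, `c` and `g₁ g₂ ∈ G` with
`g₁ⁿ ≡ xᵃyᵇ (mod [G,G])`, `g₂ⁿ ≡ xᵇyᶜ (mod [G,G])` and `[g₁,x][g₂,y] ≠ e`. -/
def Cond210 {G : Type*} [Group G] (x y : G) (n : ℕ) : Prop :=
  ∃ (a b c : ℤ) (g₁ g₂ : G),
    g₁ ^ n * (x ^ a * y ^ b)⁻¹ ∈ commutator G ∧
    g₂ ^ n * (x ^ b * y ^ c)⁻¹ ∈ commutator G ∧
    g₁⁻¹ * x⁻¹ * g₁ * x * (g₂⁻¹ * y⁻¹ * g₂ * y) ≠ 1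

/-- Condition (2.11): there exist integers `a`, `b`, `c` and `g₁ g₂ ∈ G` with
`g₁ⁿ ≡ xᵃyᵇ (mod [G,G])` and `g₂ⁿ ≡ x^{b+1}yᶜ (mod [G,G])`. -/
def Cond211 {G : Type*} [Group G] (x y : G) (n : ℕ) : Prop :=
  ∃ (a b c : ℤ) (g₁ g₂ : G),
    g₁ ^ n * (x ^ a * y ^ b)⁻¹ ∈ commutator G ∧
    g₂ ^ n * (x ^ (b + 1) * y ^ c)⁻¹ ∈ commutator G


open scoped commutatorElement

/-! ### Twisted products -/

/-- A biadditive map from a group to an additive commutative group. -/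
structure BiAdd (X : Type*) (T : Type*) [Group X] [AddCommGroup T] where
  f : X → X → T
  mul_left : ∀ a b c, f (a * b) c = f a c + f b c
  mul_right : ∀ a b c, f a (b * c) = f a b + f a c

/-- The central extension of `X` by `T` with the cocycle given by a biadditive map. -/
@[ext]
structure Tw {X : Type*} {T : Type*} [Group X] [AddCommGroup T] (β : BiAdd X T) where
  x : X
  t : T

namespace BiAdd

variable {X : Type*} {T : Type*} [Group X] [AddCommGroup T] (β : BiAdd X T)

/-- Fixing the right argument. -/
def homL (c : X) : X →* Multiplicative T :=
  MonoidHom.mk' (fun a => Multiplicative.ofAdd (β.f a c)) (fun a b => by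
    rw [β.mul_left]; rfl)

/-- Fixing the left argument. -/
def homR (c : X) : X →* Multiplicative T :=
  MonoidHom.mk' (fun a => Multiplicative.ofAdd (β.f c a)) (fun a b => by
    rw [β.mul_right]; rfl)

theorem one_left (c : X) : β.f 1 c = 0 := by
  have := β.mul_left 1 1 c
  simpa using this

theorem one_right (c : X) : β.f c 1 = 0 := by
  have := β.mul_right c 1 1
  simpa using this

theorem inv_left (a c : X) : β.f a⁻¹ c = - β.f a c := by
  have := β.mul_left a⁻¹ a c
  rw [inv_mul_cancel, β.one_left] at this
  exact eq_neg_of_add_eq_zero_left this.symm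

theorem comm_left {a : X} (ha : a ∈ commutator X) (c : X) : β.f a c = 0 := by
  have := Abelianization.commutator_subset_ker (β.homL c) ha
  exact this

theorem comm_right {a : X} (ha : a ∈ commutator X) (c : X) : β.f c a = 0 := by
  have := Abelianization.commutator_subset_ker (β.homR c) ha
  exact this

end BiAdd

namespace Tw

variable {X : Type*} {T : Type*} [Group X] [AddCommGroup T] {β : BiAdd X T}

instance : Mul (Tw β) := ⟨fun p q => ⟨p.x * q.x, p.t + q.t + β.f p.x q.x⟩⟩
instance : One (Tw β) := ⟨⟨1, 0⟩⟩
instance : Inv (Tw β) := ⟨fun p => ⟨p.x⁻¹, - p.t + β.f p.x p.x⟩⟩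

@[simp] theorem mul_x (p q : Tw β) : (p * q).x = p.x * q.x := rfl
@[simp] theorem mul_t (p q : Tw β) : (p * q).t = p.t + q.t + β.f p.x q.x := rfl
@[simp] theorem one_x : (1 : Tw β).x = 1 := rfl
@[simp] theorem one_t : (1 : Tw β).t = 0 := rfl
@[simp] theorem inv_x (p : Tw β) : (p⁻¹).x = p.x⁻¹ := rfl
@[simp] theorem inv_t (p : Tw β) : (p⁻¹).t = - p.t + β.f p.x p.x := rfl

instance : Group (Tw β) := Group.ofLeftAxioms
  (fun a b c => by
    ext
    · simp [mul_assoc]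
    · simp [β.mul_left, β.mul_right]; abel)
  (fun a => by ext <;> simp [β.one_left])
  (fun a => by
    ext
    · simp
    · simp [β.inv_left])

/-- The projection to the base group. -/
def proj : Tw β →* X := MonoidHom.mk' Tw.x (fun _ _ => rfl)

theorem mem_x {p : Tw β} (hp : p ∈ commutator (Tw β)) : p.x ∈ commutator X := by
  have h : commutator (Tw β) ≤ (commutator X).comap (proj (β := β)) := by
    rw [commutator_eq_closure, Subgroup.closure_le]
    rintro _ ⟨a, b, rfl⟩
    simp only [Subgroup.coe_comap, Set.mem_preimage, map_commutatorElement]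
    exact Subgroup.commutator_mem_commutator (Subgroup.mem_top _) (Subgroup.mem_top _)
  exact h hp

theorem central (hX : IsNil2 X) {p : Tw β} (hp : p.x ∈ commutator X) (q : Tw β) :
    q * p = p * q := by
  ext
  · simpa using Subgroup.mem_center_iff.mp (hX hp) q.x
  · simp [β.comm_left hp, β.comm_right hp, add_comm]

theorem isNil2 (hX : IsNil2 X) : IsNil2 (Tw β) := fun _ hp =>
  Subgroup.mem_center_iff.mpr (central hX (mem_x hp))

theorem comm_t (p q : Tw β) :
    ⁅p, q⁆ = ⟨⁅p.x, q.x⁆, β.f p.x q.x - β.f q.x p.x⟩ := by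
  have h1 : (⟨⁅p.x, q.x⁆, β.f p.x q.x - β.f q.x p.x⟩ : Tw β) * (q * p) = p * q := by
    have hc : ⁅p.x, q.x⁆ ∈ commutator X :=
      Subgroup.commutator_mem_commutator (Subgroup.mem_top _) (Subgroup.mem_top _)
    ext
    · simp [commutatorElement_def]
    · simp [β.comm_left hc]; abel
  rw [commutatorElement_def, mul_assoc, ← mul_inv_rev, ← h1]
  group

end Tw

/-! ### Commutator calculus -/

theorem mem_comm {G : Type*} [Group G] (a b : G) : ⁅a, b⁆ ∈ commutator G :=
  Subgroup.commutator_mem_commutator (Subgroup.mem_top _) (Subgroup.mem_top _)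

instance centerCommGroup (G : Type*) [Group G] : CommGroup (Subgroup.center G) where
  mul_comm a b := Subtype.ext (Subgroup.mem_center_iff.mp b.2 a)

/-- The commutator pairing of a nil-2 group. -/
def cm {G : Type*} [Group G] (h : IsNil2 G) : G →* G →* Subgroup.center G :=
  MonoidHom.mk' (fun a => MonoidHom.mk' (fun b => ⟨⁅a, b⁆, h (mem_comm a b)⟩) (by
    intro b c
    ext
    have := Subgroup.mem_center_iff.mp (h (mem_comm a c)) b
    simp only [Subgroup.coe_mul, commutatorElement_mul_right_eq_mul_conj]
    rw [mul_assoc, mul_assoc, ← mul_assoc b, this]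
    group)) (by
    intro a b
    ext c
    have := Subgroup.mem_center_iff.mp (h (mem_comm b c)) a
    simp only [Subgroup.coe_mul, MonoidHom.mk'_apply, MonoidHom.mul_apply]
    rw [commutatorElement_mul_left_eq_conj_mul, this, mul_inv_cancel_right]
    exact (Subgroup.mem_center_iff.mp (h (mem_comm b c)) _).symm)

theorem coe_cm {G : Type*} [Group G] (h : IsNil2 G) (a b : G) :
    (cm h a b : G) = ⁅a, b⁆ := rfl

theorem cm_comm_left {G : Type*} [Group G] (h : IsNil2 G) {a : G} (ha : a ∈ commutator G) :
    cm h a = 1 :=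
  Abelianization.commutator_subset_ker (cm h) ha

theorem cm_comm_right {G : Type*} [Group G] (h : IsNil2 G) {a : G} (ha : a ∈ commutator G)
    (b : G) : cm h b a = 1 :=
  Abelianization.commutator_subset_ker (cm h b) ha

theorem cm_self {G : Type*} [Group G] (h : IsNil2 G) (a : G) : cm h a a = 1 := by
  ext; simp [coe_cm]

theorem cm_swap {G : Type*} [Group G] (h : IsNil2 G) (a b : G) : cm h b a = (cm h a b)⁻¹ := by
  ext; simp [coe_cm]

theorem cond_eq {G : Type*} [Group G] (h : IsNil2 G) (a b : G) :
    a⁻¹ * b⁻¹ * a * b = cm h a b := by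
  have : cm h a b = cm h a⁻¹ b⁻¹ := by simp
  rw [this, coe_cm, commutatorElement_def]; simp

/-- If `a ≡ b` modulo commutators then they pair the same. -/
theorem cm_congr_left {G : Type*} [Group G] (h : IsNil2 G) {a b : G}
    (hab : a * b⁻¹ ∈ commutator G) : cm h a = cm h b := by
  have := cm_comm_left h hab
  rwa [map_mul, map_inv, mul_inv_eq_one] at this

theorem cm_congr_right {G : Type*} [Group G] (h : IsNil2 G) {a b : G}
    (hab : a * b⁻¹ ∈ commutator G) (c : G) : cm h c a = cm h c b := by
  have := cm_comm_right h hab c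
  rwa [map_mul, map_inv, mul_inv_eq_one] at this

theorem map_mem_comm {G H : Type*} [Group G] [Group H] (f : G →* H) {a : G}
    (ha : a ∈ commutator G) : f a ∈ commutator H := by
  have h : commutator G ≤ (commutator H).comap f := by
    rw [commutator_eq_closure, Subgroup.closure_le]
    rintro _ ⟨a, b, rfl⟩
    simp only [Subgroup.coe_comap, Set.mem_preimage, map_commutatorElement]
    exact mem_comm _ _
  exact h ha

/-- The key elements of the dominion. -/
theorem mem_dominion {A : Type u} [Group A] (B : Subgroup A) (r s x y : A) (n : ℕ)
    (hx : x ∈ B) (hy : y ∈ B) (hr : r ^ n * x⁻¹ ∈ commutator A)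
    (hs : s ^ n * y⁻¹ ∈ commutator A) : ⁅r, s⁆ ^ n ∈ Dominion B := by
  intro C _ hC f g hfg
  rw [map_pow, map_pow, map_commutatorElement, map_commutatorElement, ← coe_cm hC, ← coe_cm hC,
    ← Subgroup.coe_pow, ← Subgroup.coe_pow]
  congr 1
  have h1 : ∀ (k : A →* C) (c : C), cm hC (k r ^ n) c = cm hC (k x) c := by
    intro k c
    have := map_mem_comm k hr
    rw [map_mul, map_pow, map_inv] at this
    rw [cm_congr_left hC this]
  have h2 : ∀ (k : A →* C) (c : C), cm hC c (k s ^ n) = cm hC c (k y) := by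
    intro k c
    have := map_mem_comm k hs
    rw [map_mul, map_pow, map_inv] at this
    rw [cm_congr_right hC this]
  calc cm hC (f r) (f s) ^ n = cm hC (f r ^ n) (f s) := by simp
    _ = cm hC (g r ^ n) (f s) := by rw [h1, h1, hfg x hx]
    _ = cm hC (g r) (f s ^ n) := by simp
    _ = cm hC (g r) (g s ^ n) := by rw [h2, h2, hfg y hy]
    _ = _ := by simp

/-- The conditions force the key elements of the dominion into `G`. -/
theorem cond_mem {G A : Type*} [Group G] [Group A] (hG : IsNil2 G) (hA : IsNil2 A)
    (ι : G →* A) (hι : Function.Injective ι) (x y : G) (r s : A) (n : ℕ)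
    (hr : r ^ n * (ι x)⁻¹ ∈ commutator A)
    (hs : s ^ n * (ι y)⁻¹ ∈ commutator A) (h : Cond210 x y n ∨ Cond211 x y n) :
    ⁅r, s⁆ ^ n ∈ ι.range := by
  have key : ∀ (a b d c : ℤ) (g₁ g₂ : G), g₁ ^ n * (x ^ a * y ^ b)⁻¹ ∈ commutator G →
      g₂ ^ n * (x ^ d * y ^ c)⁻¹ ∈ commutator G →
      ι (⁅g₁, x⁆ * ⁅g₂, y⁆) = (((cm hA r s) ^ n) ^ (d - b) : Subgroup.center A) := by
    intro a b d c g₁ g₂ h1 h2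
    have h1' := map_mem_comm ι h1
    have h2' := map_mem_comm ι h2
    simp only [map_mul, map_pow, map_inv, map_zpow] at h1' h2'
    rw [← map_pow] at h1' h2'
    have hxr : cm hA (ι x) = cm hA (r ^ n) := (cm_congr_left hA hr).symm
    have hys : cm hA (ι y) = cm hA (s ^ n) := (cm_congr_left hA hs).symm
    have e1 : cm hA (ι g₁) (ι x) = ((cm hA r s) ^ n) ^ (-b) := by
      rw [← cm_congr_right hA hr, map_pow, ← MonoidHom.pow_apply, ← map_pow, ← map_pow,
        cm_congr_left hA h1']
      simp only [map_mul, map_zpow, MonoidHom.mul_apply, MonoidHom.zpow_apply, hxr, hys,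
        map_pow, MonoidHom.pow_apply, cm_self, cm_swap hA r s]
      simp
    have e2 : cm hA (ι g₂) (ι y) = ((cm hA r s) ^ n) ^ d := by
      rw [← cm_congr_right hA hs, map_pow, ← MonoidHom.pow_apply, ← map_pow, ← map_pow,
        cm_congr_left hA h2']
      simp only [map_mul, map_zpow, MonoidHom.mul_apply, MonoidHom.zpow_apply, hxr, hys,
        map_pow, MonoidHom.pow_apply, cm_self]
      simp
    rw [map_mul, map_commutatorElement, map_commutatorElement, ← coe_cm hA, ← coe_cm hA, e1, e2,
      ← Subgroup.coe_mul, ← zpow_add]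
    congr 2; ring
  rcases h with ⟨a, b, c, g₁, g₂, h1, h2, h3⟩ | ⟨a, b, c, g₁, g₂, h1, h2⟩
  · exfalso
    apply h3
    have := key a b b c g₁ g₂ h1 h2
    rw [cond_eq hG, cond_eq hG, coe_cm, coe_cm]
    apply hι
    rw [this]; simp
  · refine ⟨_, (key a b (b + 1) c g₁ g₂ h1 h2).trans ?_⟩
    simp [coe_cm]

theorem cond_of_div {G : Type*} [Group G] (x y : G) (n : ℕ) (h : ∃ r, r ^ n = x) :
    Cond211 x y n := by
  obtain ⟨r, hr⟩ := h
  exact ⟨1, 0, 0, r, r, by simp [hr], by simp [hr]⟩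

/-- Reduction to prime powers. -/
theorem mem_of_primePow {A : Type*} [Group A] (hA : IsNil2 A) (B : Subgroup A)
    (h : ∀ (r s : A) (q α : ℕ), q.Prime → 1 ≤ α → r ^ (q ^ α) ∈ B ⊔ commutator A →
      s ^ (q ^ α) ∈ B ⊔ commutator A → ⁅r, s⁆ ^ (q ^ α) ∈ B) (n : ℕ) :
    ∀ (r s : A), r ^ n ∈ B ⊔ commutator A → s ^ n ∈ B ⊔ commutator A → ⁅r, s⁆ ^ n ∈ B := by
  have hbi : ∀ (r s : A) (m k : ℕ), ⁅r ^ m, s ^ m⁆ ^ k = (⁅r, s⁆ ^ (m * k)) ^ m := by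
    intro r s m k
    rw [← coe_cm hA, ← coe_cm hA, ← Subgroup.coe_pow, ← Subgroup.coe_pow, ← Subgroup.coe_pow]
    congr 1
    simp only [map_pow, MonoidHom.pow_apply]
    simp only [← pow_mul]
    congr 1; ring
  induction n using Nat.recOnPosPrimePosCoprime with
  | prime_pow p n hp hn => exact fun r s => h r s p n hp hn
  | zero => intro r s _ _; simp
  | one =>
    intro r s hr hs
    have := h (r) (s) 2 1 Nat.prime_two le_rfl (Subgroup.pow_mem _ (by simpa using hr) _)
      (Subgroup.pow_mem _ (by simpa using hs) _)
    have h3 := h (r) (s) 3 1 Nat.prime_three le_rfl (Subgroup.pow_mem _ (by simpa using hr) _)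
      (Subgroup.pow_mem _ (by simpa using hs) _)
    simp only [pow_one] at *
    have := B.mul_mem h3 (B.inv_mem this)
    generalize ⁅r, s⁆ = z at *
    have hz : z ^ 3 * (z ^ 2)⁻¹ = z := by group
    rwa [hz] at this
  | coprime a b ha hb hab iha ihb =>
    intro r s hr hs
    have h1 := ihb (r ^ a) (s ^ a) (by rwa [← pow_mul]) (by rwa [← pow_mul])
    have h2 := iha (r ^ b) (s ^ b) (by rwa [← pow_mul, mul_comm]) (by rwa [← pow_mul, mul_comm])
    rw [hbi] at h1 h2
    rw [mul_comm b a] at h2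
    generalize ⁅r, s⁆ ^ (a * b) = z at *
    have hz : z = (z ^ a) ^ (a.gcdA b) * (z ^ b) ^ (a.gcdB b) := by
      rw [← zpow_natCast, ← zpow_natCast, ← zpow_mul, ← zpow_mul, ← zpow_add,
        ← Nat.gcd_eq_gcd_ab, hab.gcd_eq_one]
      simp
    rw [hz]
    exact B.mul_mem (B.zpow_mem h1 _) (B.zpow_mem h2 _)

/-! ### Abelian group algebra -/

open Finset in
theorem sum_swap_lt {W : Type*} [AddCommGroup W] {r : ℕ} (F : Fin r → Fin r → W) :
    ∑ k, ∑ j, (if k < j then F j k else 0) = ∑ k, ∑ j, (if j < k then F k j else 0) := by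
  rw [sum_comm]

theorem alt_swap {M W : Type*} [AddCommGroup M] [AddCommGroup W]
    (ω : M →+ M →+ W) (halt : ∀ m, ω m m = 0) (a b : M) : ω b a = - ω a b := by
  have := halt (a + b)
  simp only [map_add, AddMonoidHom.add_apply, halt] at this
  rw [zero_add, add_zero] at this
  exact eq_neg_of_add_eq_zero_left (by rw [add_comm] at this; simpa [add_comm] using this)

open Finset in
theorem alt_expand {M W : Type*} [AddCommGroup M] [AddCommGroup W]
    (ω : M →+ M →+ W) (halt : ∀ m, ω m m = 0) {r : ℕ} (x : Fin r → M) (a b : Fin r → ℤ) :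
    ω (∑ j, a j • x j) (∑ k, b k • x k) =
      ∑ k, ∑ j, (if j < k then (a j * b k - b j * a k) • ω (x j) (x k) else 0) := by
  have h1 : ω (∑ j, a j • x j) (∑ k, b k • x k) =
      ∑ k, ∑ j, (a j * b k) • ω (x j) (x k) := by
    simp only [map_sum, map_zsmul, AddMonoidHom.finsetSum_apply, AddMonoidHom.smul_apply,
      smul_sum, smul_smul]
    refine sum_congr rfl fun k _ => sum_congr rfl fun j _ => ?_
    rw [mul_comm]
  have h2 : ∀ k j, (a j * b k) • ω (x j) (x k) =
      (if j < k then (a j * b k) • ω (x j) (x k) else 0) +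
      (if k < j then (a j * b k) • ω (x j) (x k) else 0) := by
    intro k j
    rcases lt_trichotomy j k with h | h | h
    · simp [h, h.not_gt]
    · simp [h, halt]
    · simp [h, h.not_gt]
  rw [h1]
  rw [sum_congr rfl fun k _ => sum_congr rfl fun j _ => h2 k j]
  simp_rw [sum_add_distrib]
  rw [sum_swap_lt (fun j k => (a j * b k) • ω (x j) (x k)), ← sum_add_distrib]
  refine sum_congr rfl fun k _ => ?_
  rw [← sum_add_distrib]
  refine sum_congr rfl fun j _ => ?_
  split_ifs
  · rw [alt_swap ω halt (x j) (x k), sub_smul, smul_neg, mul_comm (a k), sub_eq_add_neg]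
  · simp

open Finset in
theorem alg_core {M W : Type*} [AddCommGroup M] [AddCommGroup W] (N : AddSubgroup M)
    (D : AddSubgroup W) (ω : M →+ M →+ W) (halt : ∀ m, ω m m = 0)
    (hD : ∀ (n : ℤ) (x y : M), n • x ∈ N → n • y ∈ N → n • ω x y ∈ D)
    {r : ℕ} (x : Fin r → M) (d : Fin r → ℤ) (hdx : ∀ j, d j • x j ∈ N)
    (S t : Fin r → Fin r → ℤ) (hS : ∀ j k, S j k = - S k j)
    (hf : ∀ k, ∑ j, S j k • x j = d k • ∑ j, t j k • x j)
    (hdvd : ∀ j k, d j ∣ S j k - d k * t j k) :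
    ∑ k, ∑ j, (if j < k then S j k • ω (x j) (x k) else 0) ∈ D := by
  choose e he using hdvd
  have hS0 : ∀ j, S j j = 0 := fun j => by have := hS j j; omega
  let p : Fin r → M := fun k =>
    ∑ j, (if j < k then e j k * d j else if k < j then - t k j * d j else 0) • x j
  have hpN : ∀ k, p k ∈ N := by
    intro k
    refine sum_mem fun j _ => ?_
    split_ifs
    · rw [mul_smul]; exact N.zsmul_mem (hdx j) _
    · rw [mul_smul]; exact N.zsmul_mem (hdx j) _
    · simp
  have hpd : ∀ k, p k = d k • ∑ j, (t j k + (if j < k then - t j k else if k < j then e k j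
      else 0)) • x j := by
    intro k
    simp_rw [add_smul, sum_add_distrib, smul_add, ← hf, smul_sum, smul_smul]
    rw [← sum_add_distrib]
    refine sum_congr rfl fun j _ => ?_
    rw [← add_smul]
    congr 1
    have h1 := he j k
    have h2 := he k j
    have h3 := hS j k
    split_ifs with h h'
    · linarith
    · linarith
    · obtain rfl : j = k := le_antisymm (not_lt.mp h') (not_lt.mp h)
      simp [hS0]
  have hsum : ∑ k, ∑ j, (if j < k then S j k • ω (x j) (x k) else 0) = ∑ k, ω (p k) (x k) := by
    have h2 : ∀ k, ω (p k) (x k) = ∑ j, (if j < k then (e j k * d j) • ω (x j) (x k) else 0) +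
        ∑ j, (if k < j then (- t k j * d j) • ω (x j) (x k) else 0) := by
      intro k
      rw [← sum_add_distrib]
      simp only [p, map_sum, map_zsmul, AddMonoidHom.finsetSum_apply, AddMonoidHom.smul_apply]
      refine sum_congr rfl fun j _ => ?_
      rcases lt_trichotomy j k with h | h | h
      · simp [h, h.not_gt]
      · simp [h]
      · simp [h, h.not_gt]
    simp_rw [h2]
    rw [sum_add_distrib, sum_swap_lt (fun j k => (- t k j * d j) • ω (x j) (x k)),
      ← sum_add_distrib]
    refine sum_congr rfl fun k _ => ?_
    rw [← sum_add_distrib]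
    refine sum_congr rfl fun j _ => ?_
    split_ifs
    · rw [alt_swap ω halt (x j) (x k), smul_neg, ← neg_smul, ← add_smul]
      congr 1
      have := he j k
      linarith
    · simp
  rw [hsum]
  refine sum_mem fun k _ => ?_
  have h1 := hpN k
  rw [hpd] at h1 ⊢
  rw [map_zsmul, AddMonoidHom.smul_apply]
  exact hD _ _ _ h1 (hdx k)

theorem exists_coords {M : Type*} [AddCommGroup M] (N : AddSubgroup M) (s : Finset M) :
    ∃ (r : ℕ) (x : Fin r → M) (d : Fin r → ℤ), (∀ j, x j ∈ AddSubgroup.closure (s : Set M)) ∧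
      (∀ m ∈ AddSubgroup.closure (s : Set M), ∃ c : Fin r → ℤ, m = ∑ j, c j • x j) ∧
      (∀ j, d j • x j ∈ N) ∧
      (∀ c : Fin r → ℤ, ∑ j, c j • x j ∈ N → ∀ j, d j ∣ c j) := by
  classical
  let v : Fin s.card → M := fun i => (s.equivFin.symm i : M)
  let L : (Fin s.card → ℤ) →ₗ[ℤ] M := Fintype.linearCombination ℤ v
  let P : Submodule ℤ (Fin s.card → ℤ) := (AddSubgroup.toIntSubmodule N).comap L
  obtain ⟨n, snf⟩ := P.smithNormalForm (Pi.basisFun ℤ (Fin s.card))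
  have hLmem : ∀ w, L w ∈ AddSubgroup.closure (s : Set M) := by
    intro w
    rw [Fintype.linearCombination_apply]
    exact sum_mem fun i _ => AddSubgroup.zsmul_mem _
      (AddSubgroup.subset_closure (s.equivFin.symm i).2) _
  have hLsum : ∀ c : Fin s.card → ℤ, L (∑ j, c j • snf.bM j) = ∑ j, c j • L (snf.bM j) := by
    intro c; simp only [map_sum, map_smul]
  refine ⟨s.card, fun j => L (snf.bM j),
    fun j => if h : ∃ i, snf.f i = j then snf.a h.choose else 0, fun j => hLmem _, ?_, ?_, ?_⟩
  · intro m hm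
    have : ∃ w, L w = m := by
      have hle : AddSubgroup.closure (s : Set M) ≤ L.toAddMonoidHom.range := by
        rw [AddSubgroup.closure_le]
        intro a ha
        refine ⟨Pi.single (s.equivFin ⟨a, ha⟩) 1, ?_⟩
        simp [L, v]
      exact hle hm
    obtain ⟨w, rfl⟩ := this
    refine ⟨fun j => snf.bM.repr w j, ?_⟩
    rw [← hLsum, snf.bM.sum_repr]
  · intro j
    dsimp only
    split_ifs with h
    · have h1 := snf.snf h.choose
      have h2 : (snf.bN h.choose : Fin s.card → ℤ) ∈ P := (snf.bN h.choose).2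
      rw [h1, h.choose_spec] at h2
      have h3 : L (snf.a h.choose • snf.bM j) ∈ N := h2
      rwa [map_smul] at h3
    · simp
  · intro c hc j
    rw [← hLsum] at hc
    have hP : (∑ j, c j • snf.bM j) ∈ P := hc
    have hrep : snf.bM.repr (∑ j, c j • snf.bM j) j = c j := by
      rw [snf.bM.repr_sum_self]
    dsimp only
    split_ifs with h
    · have := snf.repr_apply_embedding_eq_repr_smul (m := ⟨_, hP⟩) (i := h.choose)
      rw [h.choose_spec] at this
      simp only [hrep] at this
      rw [this, map_smul, Finsupp.smul_apply]
      exact Dvd.intro _ rfl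
    · have := snf.repr_eq_zero_of_notMem_range ⟨_, hP⟩ (i := j) (by rintro ⟨i, hi⟩; exact h ⟨i, hi⟩)
      simp only [hrep] at this
      simp [this]

/-- Relations defining the tensor product of `M` and `M / N`. -/
def relSet {M : Type*} [AddCommGroup M] (N : AddSubgroup M) : Set (FreeAbelianGroup (M × M)) :=
  {z | (∃ a a' b, z = .of (a + a', b) - .of (a, b) - .of (a', b)) ∨
    (∃ a b b', z = .of (a, b + b') - .of (a, b) - .of (a, b')) ∨ ∃ a, ∃ b ∈ N, z = .of (a, b)}

/-- The subgroup of relations. -/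
def relS {M : Type*} [AddCommGroup M] (N : AddSubgroup M) :
    AddSubgroup (FreeAbelianGroup (M × M)) := AddSubgroup.closure (relSet N)

theorem relS_fin {M : Type u} [AddCommGroup M] (N : AddSubgroup M)
    {z : FreeAbelianGroup (M × M)} (hz : z ∈ relS N) :
    ∃ s : Finset M, ∀ M0 : AddSubgroup M, (s : Set M) ⊆ M0 →
      ∀ (Y : Type u) [AddCommGroup Y] (h : M → M → Y),
      (∀ a ∈ M0, ∀ a' ∈ M0, ∀ b ∈ M0, h (a + a') b = h a b + h a' b) →
      (∀ a ∈ M0, ∀ b ∈ M0, ∀ b' ∈ M0, h a (b + b') = h a b + h a b') →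
      (∀ a ∈ M0, ∀ b ∈ M0, b ∈ N → h a b = 0) →
      FreeAbelianGroup.lift (fun p : M × M => h p.1 p.2) z = 0 := by
  classical
  unfold relS at hz
  induction hz using AddSubgroup.closure_induction with
  | mem z hz =>
    rcases hz with ⟨a, a', b, rfl⟩ | ⟨a, b, b', rfl⟩ | ⟨a, b, hb, rfl⟩
    · refine ⟨{a, a', b}, fun M0 hM Y _ h h1 h2 h3 => ?_⟩
      simp only [Finset.coe_insert, Finset.coe_singleton, Set.insert_subset_iff,
        Set.singleton_subset_iff] at hM
      simp [h1 a hM.1 a' hM.2.1 b hM.2.2]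
    · refine ⟨{a, b, b'}, fun M0 hM Y _ h h1 h2 h3 => ?_⟩
      simp only [Finset.coe_insert, Finset.coe_singleton, Set.insert_subset_iff,
        Set.singleton_subset_iff] at hM
      simp [h2 a hM.1 b hM.2.1 b' hM.2.2]
    · refine ⟨{a, b}, fun M0 hM Y _ h h1 h2 h3 => ?_⟩
      simp only [Finset.coe_insert, Finset.coe_singleton, Set.insert_subset_iff,
        Set.singleton_subset_iff] at hM
      simp [h3 a hM.1 b hM.2 hb]
  | zero => exact ⟨∅, fun M0 hM Y _ h h1 h2 h3 => by simp⟩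
  | add x y _ _ ihx ihy =>
    obtain ⟨s, hs⟩ := ihx
    obtain ⟨s', hs'⟩ := ihy
    refine ⟨s ∪ s', fun M0 hM Y _ h h1 h2 h3 => ?_⟩
    rw [Finset.coe_union, Set.union_subset_iff] at hM
    rw [map_add, hs M0 hM.1 Y h h1 h2 h3, hs' M0 hM.2 Y h h1 h2 h3, add_zero]
  | neg x _ ihx =>
    obtain ⟨s, hs⟩ := ihx
    refine ⟨s, fun M0 hM Y _ h h1 h2 h3 => ?_⟩
    rw [map_neg, hs M0 hM Y h h1 h2 h3, neg_zero]

open Finset in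
theorem alg_main {M : Type u} {W : Type*} [AddCommGroup M] [AddCommGroup W] (N : AddSubgroup M)
    (D : AddSubgroup W) (ω : M →+ M →+ W) (halt : ∀ m, ω m m = 0)
    (hD : ∀ (n : ℤ) (x y : M), n • x ∈ N → n • y ∈ N → n • ω x y ∈ D)
    {n : ℕ} (u v : Fin n → M)
    (huv : ∑ i, (FreeAbelianGroup.of (u i, v i) - FreeAbelianGroup.of (v i, u i)) ∈ relS N) :
    ∑ i, ω (u i) (v i) ∈ D := by
  classical
  obtain ⟨s, hs⟩ := relS_fin N huv
  let s' : Finset M := s ∪ (univ.image u ∪ univ.image v)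
  let M0 : AddSubgroup M := AddSubgroup.closure (s' : Set M)
  have hs' : (s' : Set M) ⊆ M0 := AddSubgroup.subset_closure
  have hsM : (s : Set M) ⊆ M0 := fun a ha => hs' (by simp [s', Finset.mem_coe.mp ha])
  have hu : ∀ i, u i ∈ M0 := fun i => hs' (by simp [s'])
  have hv : ∀ i, v i ∈ M0 := fun i => hs' (by simp [s'])
  obtain ⟨r, x, d, hx, hc, hdx, hdvd⟩ := exists_coords N s'
  have hc' : ∀ m : M, ∃ c : Fin r → ℤ, m ∈ M0 → m = ∑ j, c j • x j := by
    intro m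
    by_cases hm : m ∈ M0
    · obtain ⟨c, hc⟩ := hc m hm
      exact ⟨c, fun _ => hc⟩
    · exact ⟨0, fun h => absurd h hm⟩
  choose co hco using hc'
  have hadd : ∀ b ∈ M0, ∀ b' ∈ M0, ∀ k, d k ∣ co (b + b') k - co b k - co b' k := by
    intro b hb b' hb'
    apply hdvd (fun k => co (b + b') k - co b k - co b' k)
    simp_rw [sub_smul, sum_sub_distrib]
    rw [← hco _ hb, ← hco _ hb', ← hco _ (M0.add_mem hb hb')]
    simp
  have hN : ∀ b ∈ M0, b ∈ N → ∀ k, d k ∣ co b k := by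
    intro b hb hbN
    apply hdvd
    rwa [← hco _ hb]
  have hk : ∀ k, ∃ f ∈ M0, ∑ i, (co (v i) k • u i - co (u i) k • v i) = d k • f := by
    intro k
    let R : AddSubgroup M := M0.map (zsmulAddGroupHom (d k))
    have hR : ∀ a ∈ M0, ∀ z, d k ∣ z → (z • a : M) ∈ R := by
      rintro a ha _ ⟨z, rfl⟩
      exact ⟨z • a, M0.zsmul_mem ha z, by simp [mul_smul]⟩
    have := hs M0 hsM (M ⧸ R) (fun a b => QuotientAddGroup.mk' R (co b k • a)) (by
      intro a ha a' ha' b hb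
      simp only [smul_add, map_add]) (by
      intro a ha b hb b' hb'
      rw [← map_add, ← sub_eq_zero, ← map_sub, ← add_smul, ← sub_smul]
      refine (QuotientAddGroup.eq_zero_iff _).mpr (hR _ ha _ ?_)
      have := hadd b hb b' hb' k
      rwa [sub_sub] at this) (by
      intro a ha b hb hbN
      exact (QuotientAddGroup.eq_zero_iff _).mpr (hR _ ha _ (hN b hb hbN k)))
    simp only [map_sum, map_sub, FreeAbelianGroup.lift_apply_of] at this
    simp only [← map_sub, ← map_sum] at this
    obtain ⟨f, hf, hf'⟩ := (QuotientAddGroup.eq_zero_iff _).mp this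
    exact ⟨f, hf, by simpa using hf'.symm⟩
  choose f hf hfe using hk
  let S : Fin r → Fin r → ℤ := fun j k =>
    ∑ i, (co (u i) j * co (v i) k - co (v i) j * co (u i) k)
  let t : Fin r → Fin r → ℤ := fun j k => co (f k) j
  have hsum : ∑ i, ω (u i) (v i) = ∑ k, ∑ j, (if j < k then S j k • ω (x j) (x k) else 0) := by
    have : ∀ i, ω (u i) (v i) = ∑ k, ∑ j, (if j < k then
        (co (u i) j * co (v i) k - co (v i) j * co (u i) k) • ω (x j) (x k) else 0) := fun i => by
      have := alt_expand ω halt x (co (u i)) (co (v i))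
      rw [← hco _ (hu i), ← hco _ (hv i)] at this
      exact this
    rw [sum_congr rfl fun i _ => this i, sum_comm]
    refine sum_congr rfl fun k _ => ?_
    rw [sum_comm]
    refine sum_congr rfl fun j _ => ?_
    split_ifs
    · simp only [S, sum_smul]
    · simp
  have hSx : ∀ k, ∑ j, S j k • x j = d k • f k := by
    intro k
    rw [← hfe]
    simp only [S, sum_smul]
    rw [sum_comm]
    refine sum_congr rfl fun i _ => ?_
    conv_rhs => rw [hco _ (hu i), hco _ (hv i)]
    rw [smul_sum, smul_sum, ← sum_sub_distrib]
    refine sum_congr rfl fun j _ => ?_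
    rw [sub_smul, smul_smul, smul_smul, mul_comm (co (u i) j), mul_comm (co (v i) j)]
    congr 3
    · rw [← hco _ (hv i)]
    · rw [← hco _ (hu i)]
  have hft : ∀ k, ∑ j, t j k • x j = f k := fun k => (hco _ (hf k)).symm
  rw [hsum]
  refine alg_core N D ω halt hD x d hdx S t ?_ ?_ ?_
  · intro j k
    simp only [S, ← sum_neg_distrib]
    exact sum_congr rfl fun i _ => by ring
  · intro k
    rw [hSx, hft]
  · intro j k
    apply hdvd (fun j => S j k - d k * t j k)
    simp_rw [sub_smul, sum_sub_distrib, mul_smul, ← smul_sum]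
    rw [hSx, hft]
    simp

/-! ### Subgroups closed in the sense of dominions -/

theorem isNil2_of {G : Type*} [Group G] (h : ∀ a b c : G, c * ⁅a, b⁆ = ⁅a, b⁆ * c) :
    IsNil2 G := by
  unfold IsNil2
  rw [commutator_eq_closure, Subgroup.closure_le]
  rintro _ ⟨a, b, rfl⟩
  exact Subgroup.mem_center_iff.mpr (h a b)

theorem mem_comm_of_ab {G : Type*} [Group G] {a b : G}
    (h : Abelianization.of a = Abelianization.of b) : a * b⁻¹ ∈ commutator G := by
  rw [← Abelianization.ker_of, MonoidHom.mem_ker, map_mul, map_inv, h, mul_inv_cancel]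

/-- The class in the additive abelianization. -/
def ab {G : Type*} [Group G] (a : G) : Additive (Abelianization G) :=
  Additive.ofMul (Abelianization.of a)

theorem ab_mul {G : Type*} [Group G] (a b : G) : ab (a * b) = ab a + ab b := by
  simp [ab]

theorem ab_surj {G : Type*} [Group G] (m : Additive (Abelianization G)) : ∃ a : G, ab a = m :=
  QuotientGroup.mk_surjective m.toMul

/-- The image of a subgroup in the additive abelianization. -/
def abN {G : Type*} [Group G] (B : Subgroup G) : AddSubgroup (Additive (Abelianization G)) :=
  Subgroup.toAddSubgroup (B.map Abelianization.of)

theorem mem_abN {G : Type*} [Group G] (B : Subgroup G) (a : G) :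
    ab a ∈ abN B ↔ Abelianization.of a ∈ B.map Abelianization.of := Iff.rfl

/-- The commutator pairing on the abelianization. -/
def omg {G : Type*} [Group G] (h : IsNil2 G) : Additive (Abelianization G) →+
    Additive (Abelianization G) →+ Additive (Subgroup.center G) :=
  AddMonoidHom.mk' (fun m => MonoidHom.toAdditive ((Abelianization.lift
    (MonoidHom.mk' (fun a => Abelianization.lift (cm h a)) (by
      intro a b
      apply Abelianization.hom_ext
      ext c
      simp))) m.toMul)) (by
    intro a b
    ext c
    simp)

theorem omg_ab {G : Type*} [Group G] (h : IsNil2 G) (a b : G) :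
    omg h (ab a) (ab b) = Additive.ofMul (cm h a b) := rfl

theorem list_swap {P W : Type*} [AddCommGroup W] (F : P → P → W) (h : ∀ a b, F b a = - F a b)
    (l : List (P × P)) :
    ((l.map Prod.swap).map fun p => F p.1 p.2).sum = - (l.map fun p => F p.1 p.2).sum := by
  induction l with
  | nil => simp
  | cons p l ih =>
    simp only [List.map_cons, List.sum_cons, ih, Prod.fst_swap, Prod.snd_swap, h p.1 p.2]
    abel

/-- The target of the universal biadditive map. -/
abbrev TT {A : Type u} [Group A] (B : Subgroup A) : Type u :=
  FreeAbelianGroup (Additive (Abelianization A) × Additive (Abelianization A)) ⧸ relS (abN B)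

/-- The universal biadditive map. -/
def bE {A : Type u} [Group A] (B : Subgroup A) : BiAdd A (TT B) where
  f a b := QuotientAddGroup.mk' (relS (abN B)) (FreeAbelianGroup.of (ab a, ab b))
  mul_left a b c := by
    rw [ab_mul, ← map_add, ← sub_eq_zero, ← map_sub]
    refine (QuotientAddGroup.eq_zero_iff _).mpr (AddSubgroup.subset_closure (Or.inl ?_))
    exact ⟨_, _, _, (sub_sub _ _ _).symm⟩
  mul_right a b c := by
    rw [ab_mul, ← map_add, ← sub_eq_zero, ← map_sub]
    refine (QuotientAddGroup.eq_zero_iff _).mpr (AddSubgroup.subset_closure (Or.inr (Or.inl ?_)))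
    exact ⟨_, _, _, (sub_sub _ _ _).symm⟩

theorem bE_zero {A : Type u} [Group A] (B : Subgroup A) (a b : A)
    (hb : Abelianization.of b ∈ B.map Abelianization.of) : (bE B).f a b = 0 :=
  (QuotientAddGroup.eq_zero_iff _).mpr (AddSubgroup.subset_closure (Or.inr (Or.inr
    ⟨_, _, (mem_abN B b).mpr hb, rfl⟩)))

theorem comm_list {A : Type u} [Group A] (hA : IsNil2 A) (B : Subgroup A) (e : Tw (bE B))
    (he : e ∈ commutator (Tw (bE B))) : ∃ l : List (A × A),
      e.x = (((l.map fun p => Additive.ofMul (cm hA p.1 p.2)).sum).toMul : Subgroup.center A) ∧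
      e.t = (l.map fun p => (bE B).f p.1 p.2 - (bE B).f p.2 p.1).sum := by
  rw [commutator_eq_closure] at he
  induction he using Subgroup.closure_induction with
  | mem e he =>
    obtain ⟨p, q, rfl⟩ := he
    refine ⟨[(p.x, q.x)], ?_, ?_⟩
    · rw [Tw.comm_t]; simp [coe_cm]
    · rw [Tw.comm_t]; simp
  | one => exact ⟨[], by simp, by simp⟩
  | mul e e' he he' ih ih' =>
    obtain ⟨l, h1, h2⟩ := ih
    obtain ⟨l', h1', h2'⟩ := ih'
    rw [← commutator_eq_closure] at he
    refine ⟨l ++ l', ?_, ?_⟩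
    · rw [Tw.mul_x, h1, h1']; simp
    · rw [Tw.mul_t, h2, h2', (bE B).comm_left (Tw.mem_x he)]; simp
  | inv e he ih =>
    obtain ⟨l, h1, h2⟩ := ih
    rw [← commutator_eq_closure] at he
    refine ⟨l.map Prod.swap, ?_, ?_⟩
    · rw [list_swap (fun a b => Additive.ofMul (cm hA a b)), Tw.inv_x, h1]
      · simp
      · intro a b; rw [cm_swap hA a b]; rfl
    · rw [list_swap (fun a b => (bE B).f a b - (bE B).f b a), Tw.inv_t, h2,
        (bE B).comm_left (Tw.mem_x he)]
      · simp
      · intro a b; abel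

theorem mem_of_comm {A : Type u} [Group A] (hA : IsNil2 A) (B : Subgroup A)
    (h : ∀ (n : ℕ) (r s : A), r ^ n ∈ B ⊔ commutator A → s ^ n ∈ B ⊔ commutator A →
      ⁅r, s⁆ ^ n ∈ B) (c : A) (hc : (⟨c, 0⟩ : Tw (bE B)) ∈ commutator (Tw (bE B))) : c ∈ B := by
  obtain ⟨l, h1, h2⟩ := comm_list hA B _ hc
  let D : AddSubgroup (Additive (Subgroup.center A)) :=
    Subgroup.toAddSubgroup (B.subgroupOf (Subgroup.center A))
  suffices hs : (l.map fun p => Additive.ofMul (cm hA p.1 p.2)).sum ∈ D by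
    have : (((l.map fun p => Additive.ofMul (cm hA p.1 p.2)).sum).toMul : A) ∈ B := hs
    rw [← h1] at this
    exact this
  have hnat : ∀ (n : ℕ) (x y : Additive (Abelianization A)), n • x ∈ abN B → n • y ∈ abN B →
      n • omg hA x y ∈ D := by
    intro n x y hx hy
    obtain ⟨a, rfl⟩ := ab_surj x
    obtain ⟨b, rfl⟩ := ab_surj y
    have hab : ∀ a : A, n • ab a ∈ abN B → a ^ n ∈ B ⊔ commutator A := by
      rintro a ⟨b, hb, hba⟩
      have hba' : Abelianization.of (a ^ n) = Abelianization.of b := by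
        rw [map_pow]; exact hba.symm
      have := mem_comm_of_ab hba'
      have h3 := Subgroup.mul_mem_sup hb (SetLike.mem_coe.mp this)
      have h4 := (B ⊔ commutator A).mul_mem (Subgroup.mem_sup_right this)
        (Subgroup.mem_sup_left hb)
      simpa using h4
    exact h n a b (hab a hx) (hab b hy)
  have := alg_main (abN B) D (omg hA) (by
      intro m
      obtain ⟨a, rfl⟩ := ab_surj m
      rw [omg_ab, cm_self]; rfl) (by
      intro n x y hx hy
      obtain ⟨k, rfl | rfl⟩ := n.eq_nat_or_neg
      · rw [natCast_zsmul] at *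
        exact hnat k x y hx hy
      · rw [neg_smul, natCast_zsmul] at *
        exact D.neg_mem (hnat k x y (by simpa using hx) (by simpa using hy)))
    (n := l.length) (fun i => ab l[i.1].1) (fun i => ab l[i.1].2) (by
      rw [Fin.sum_univ_fun_getElem l (fun p => FreeAbelianGroup.of (ab p.1, ab p.2) -
        FreeAbelianGroup.of (ab p.2, ab p.1))]
      rw [← QuotientAddGroup.eq_zero_iff]
      refine Eq.trans ?_ h2.symm
      change (QuotientAddGroup.mk' _) _ = _
      rw [map_list_sum, List.map_map]
      rfl)
  rw [Fin.sum_univ_fun_getElem l (fun p => omg hA (ab p.1) (ab p.2))] at this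
  exact this

section target

variable {A : Type u} [Group A] (B : Subgroup A)

/-- Elements of `B` inside the extension. -/
def BE : Subgroup (Tw (bE B)) where
  carrier := {e | e.x ∈ B ∧ e.t = 0}
  one_mem' := ⟨B.one_mem, rfl⟩
  mul_mem' := by
    rintro a b ⟨ha, ha'⟩ ⟨hb, hb'⟩
    exact ⟨B.mul_mem ha hb, by
      simp [ha', hb', bE_zero B a.x b.x (Subgroup.mem_map_of_mem _ hb)]⟩
  inv_mem' := by
    rintro a ⟨ha, ha'⟩
    exact ⟨B.inv_mem ha, by
      simp [ha', bE_zero B a.x a.x (Subgroup.mem_map_of_mem _ ha)]⟩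

/-- The quotient of the abelianization. -/
abbrev VV : Type u := Abelianization (Tw (bE B)) ⧸ (BE B).map Abelianization.of

/-- The quotient map. -/
def kap : Tw (bE B) →* VV B := (QuotientGroup.mk' _).comp Abelianization.of

/-- The quotient of `A` by `B` and commutators. -/
abbrev QQ : Type u := Abelianization A ⧸ B.map Abelianization.of

/-- The quotient map. -/
def prQ : A →* QQ B := (QuotientGroup.mk' _).comp Abelianization.of

theorem prQ_surj : Function.Surjective (prQ B) :=
  (QuotientGroup.mk'_surjective _).comp QuotientGroup.mk_surjective

/-- A section. -/
noncomputable def secQ (q : QQ B) : A := Function.surjInv (prQ_surj B) q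

theorem prQ_secQ (q : QQ B) : prQ B (secQ B q) = q := Function.surjInv_eq _ q

theorem bE_congr (a b b' : A) (h : prQ B b = prQ B b') : (bE B).f a b = (bE B).f a b' := by
  have h1 : prQ B (b'⁻¹ * b) = 1 := by rw [map_mul, h, map_inv, inv_mul_cancel]
  have h2 := bE_zero B a (b'⁻¹ * b) ((QuotientGroup.eq_one_iff _).mp h1)
  have h3 := (bE B).mul_right a b' (b'⁻¹ * b)
  rwa [mul_inv_cancel_left, h2, add_zero] at h3

/-- The inclusion of the fibre. -/
def thV (t : TT B) : Additive (VV B) := Additive.ofMul (kap B ⟨1, t⟩)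

theorem thV_add (t t' : TT B) : thV B (t + t') = thV B t + thV B t' := by
  have : (⟨1, t + t'⟩ : Tw (bE B)) = ⟨1, t⟩ * ⟨1, t'⟩ := by
    ext
    · simp
    · simp [(bE B).one_left]
  simp [thV, this]

/-- The cocycle of the target. -/
noncomputable def bC : BiAdd (A × QQ B) (Additive (VV B)) where
  f p q := thV B ((bE B).f p.1 (secQ B q.2))
  mul_left a b c := by rw [← thV_add, ← (bE B).mul_left]; rfl
  mul_right a b c := by
    rw [← thV_add, ← (bE B).mul_right]
    congr 1
    apply bE_congr
    rw [map_mul, prQ_secQ, prQ_secQ, prQ_secQ]; rfl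

theorem thV_zero : thV B 0 = 0 := by
  have := thV_add B 0 0
  simpa using this

/-- First map. -/
noncomputable def fC : A →* Tw (bC B) := MonoidHom.mk' (fun a => ⟨(a, 1), 0⟩) (by
  intro a b
  refine Tw.ext (Prod.ext rfl (mul_one _).symm) ?_
  have h : (bE B).f a (secQ B 1) = 0 := by
    rw [bE_congr B a (secQ B 1) 1 (by rw [prQ_secQ, map_one]), (bE B).one_right]
  show (0 : Additive (VV B)) = 0 + 0 + thV B ((bE B).f a (secQ B 1))
  rw [h, thV_zero, add_zero, add_zero])

/-- Second map. -/
noncomputable def gC : A →* Tw (bC B) :=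
  MonoidHom.mk' (fun a => ⟨(a, prQ B a), - Additive.ofMul (kap B ⟨a, 0⟩)⟩) (by
  intro a b
  refine Tw.ext (Prod.ext rfl (map_mul _ _ _)) ?_
  have h : (bE B).f a (secQ B (prQ B b)) = (bE B).f a b := bE_congr B _ _ _ (prQ_secQ B _)
  have h2 : (⟨a, 0⟩ * ⟨b, 0⟩ : Tw (bE B)) = ⟨a * b, 0⟩ * ⟨1, (bE B).f a b⟩ := by
    ext
    · simp
    · simp [(bE B).one_right]
  have h3 := congrArg (fun e => Additive.ofMul (kap B e)) h2
  simp only [map_mul, ofMul_mul] at h3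
  show - Additive.ofMul (kap B ⟨a * b, 0⟩) = - Additive.ofMul (kap B ⟨a, 0⟩) +
    - Additive.ofMul (kap B ⟨b, 0⟩) + thV B ((bE B).f a (secQ B (prQ B b)))
  rw [h, ← neg_add, h3]
  unfold thV
  abel)

theorem closed_of (hA : IsNil2 A)
    (h : ∀ (n : ℕ) (r s : A), r ^ n ∈ B ⊔ commutator A → s ^ n ∈ B ⊔ commutator A →
      ⁅r, s⁆ ^ n ∈ B) : Dominion B = (B : Set A) := by
  apply Set.Subset.antisymm
  · intro a ha
    have hX : IsNil2 (A × QQ B) := by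
      apply isNil2_of
      rintro ⟨a, q⟩ ⟨a', q'⟩ ⟨a₃, q₃⟩
      ext
      · exact Subgroup.mem_center_iff.mp (hA (mem_comm a a')) a₃
      · exact mul_comm _ _
    have key := ha (Tw (bC B)) (Tw.isNil2 hX) (fC B) (gC B) (by
      intro b hb
      have h1 : prQ B b = 1 :=
        (QuotientGroup.eq_one_iff _).mpr (Subgroup.mem_map_of_mem _ hb)
      have h2 : kap B ⟨b, 0⟩ = 1 :=
        (QuotientGroup.eq_one_iff _).mpr (Subgroup.mem_map_of_mem _ ⟨hb, rfl⟩)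
      simp [fC, gC, h1, h2])
    have hk : kap B ⟨a, 0⟩ = 1 := by
      have : (0 : Additive (VV B)) = - Additive.ofMul (kap B ⟨a, 0⟩) := congrArg Tw.t key
      have h0 : Additive.ofMul (kap B ⟨a, 0⟩) = 0 := neg_eq_zero.mp this.symm
      exact h0
    obtain ⟨⟨b, t⟩, ⟨hb, ht⟩, hab⟩ := (QuotientGroup.eq_one_iff _).mp hk
    simp only at hb ht
    subst ht
    have h1 := mem_comm_of_ab hab.symm
    have h2 : (⟨a, 0⟩ * (⟨b, 0⟩)⁻¹ : Tw (bE B)) = ⟨a * b⁻¹, 0⟩ := by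
      ext
      · simp
      · simp [bE_zero B b b (Subgroup.mem_map_of_mem _ hb),
          bE_zero B a b⁻¹ (Subgroup.mem_map_of_mem _ (B.inv_mem hb))]
    rw [h2] at h1
    have := B.mul_mem (mem_of_comm hA B h _ h1) hb
    simpa using this
  · intro b hb C _ _ f g hfg
    exact hfg b hb

end target

/-! ### Constructing extensions -/

theorem isNil2_surj {H K : Type*} [Group H] [Group K] (h : IsNil2 H) (f : H →* K)
    (hf : Function.Surjective f) : IsNil2 K := by
  apply isNil2_of
  intro a b c
  obtain ⟨a, rfl⟩ := hf a
  obtain ⟨b, rfl⟩ := hf b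
  obtain ⟨c, rfl⟩ := hf c
  rw [← map_commutatorElement, ← map_mul, ← map_mul,
    Subgroup.mem_center_iff.mp (h (mem_comm a b)) c]

theorem normal_of_central {H : Type*} [Group H] (K : Subgroup H) (h : K ≤ Subgroup.center H) :
    K.Normal :=
  ⟨fun k hk g => by rwa [Subgroup.mem_center_iff.mp (h hk) g, mul_inv_cancel_right]⟩

theorem not_closed {G H : Type u} [Group G] [Group H] (hH : IsNil2 H) (ι : G →* H)
    (hι : Function.Injective ι) (x y : G) (r s : H) (n : ℕ) (hn : 0 < n)
    (hr : r ^ n * (ι x)⁻¹ ∈ Subgroup.center H) (hs : s ^ n * (ι y)⁻¹ ∈ Subgroup.center H)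
    (p q : H →* Multiplicative ℤ) (hpι : ∀ g, p (ι g) = 1) (hqι : ∀ g, q (ι g) = 1)
    (hpr : p r = Multiplicative.ofAdd 1) (hps : p s = 1)
    (hqr : q r = 1) (hqs : q s = Multiplicative.ofAdd 1)
    (hrs : ⁅r, s⁆ ^ n ∉ ι.range) : ¬ IsAbsolutelyClosed G := by
  intro hcl
  set z := r ^ n * (ι x)⁻¹ with hz
  set w := s ^ n * (ι y)⁻¹ with hw
  have hZ : Subgroup.zpowers z ≤ Subgroup.center H := by
    rwa [Subgroup.zpowers_le]
  have hW : Subgroup.zpowers w ≤ Subgroup.center H := by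
    rwa [Subgroup.zpowers_le]
  have hWn := normal_of_central _ hW
  have hKn := normal_of_central (Subgroup.zpowers z ⊔ Subgroup.zpowers w) (sup_le hZ hW)
  have hpz : p z = Multiplicative.ofAdd (n : ℤ) := by
    rw [hz, map_mul, map_pow, map_inv, hpι, hpr, inv_one, mul_one, ← ofAdd_nsmul]; simp
  have hqw : q w = Multiplicative.ofAdd (n : ℤ) := by
    rw [hw, map_mul, map_pow, map_inv, hqι, hqs, inv_one, mul_one, ← ofAdd_nsmul]; simp
  have hpw : p w = 1 := by simp [hw, hpι, hps]
  have hqz : q z = 1 := by simp [hz, hqι, hqr]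
  have hn' : (n : ℤ) ≠ 0 := by exact_mod_cast hn.ne'
  have key : ∀ k ∈ Subgroup.zpowers z ⊔ Subgroup.zpowers w, p k = 1 → q k = 1 → k = 1 := by
    intro k hk hp hq
    obtain ⟨_, ⟨i, rfl⟩, _, ⟨j, rfl⟩, rfl⟩ := Subgroup.mem_sup_of_normal_right.mp hk
    simp only [map_mul, map_zpow, hpz, hpw, hqz, hqw, one_zpow, mul_one, one_mul,
      ← ofAdd_zsmul, ofAdd_eq_one, smul_eq_mul, mul_eq_zero, hn', or_false] at hp hq
    simp [hp, hq]
  let π := QuotientGroup.mk' (Subgroup.zpowers z ⊔ Subgroup.zpowers w)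
  have hinj : Function.Injective (π.comp ι) := by
    rw [injective_iff_map_eq_one]
    intro g hg
    have := key (ι g) ((QuotientGroup.eq_one_iff _).mp hg) (hpι g) (hqι g)
    exact hι (this.trans (map_one ι).symm)
  have hdom := hcl _ (isNil2_surj hH π (QuotientGroup.mk'_surjective _)) (π.comp ι) hinj
  have hz1 : π z = 1 := (QuotientGroup.eq_one_iff _).mpr
    (Subgroup.mem_sup_left (Subgroup.mem_zpowers z))
  have hw1 : π w = 1 := (QuotientGroup.eq_one_iff _).mpr
    (Subgroup.mem_sup_right (Subgroup.mem_zpowers w))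
  have hmem := mem_dominion (π.comp ι).range (π r) (π s) (π (ι x)) (π (ι y)) n
    ⟨x, rfl⟩ ⟨y, rfl⟩
    (by rw [← map_pow, ← map_inv, ← map_mul, ← hz, hz1]; exact one_mem _)
    (by rw [← map_pow, ← map_inv, ← map_mul, ← hw, hw1]; exact one_mem _)
  rw [hdom] at hmem
  obtain ⟨g, hg⟩ := hmem
  rw [← map_commutatorElement, ← map_pow] at hg
  have h1 : ⁅r, s⁆ ^ n * (ι g)⁻¹ ∈ Subgroup.zpowers z ⊔ Subgroup.zpowers w := by
    rw [← QuotientGroup.eq_one_iff]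
    change π (⁅r, s⁆ ^ n * (ι g)⁻¹) = 1
    rw [map_mul, ← hg, map_inv]; exact mul_inv_cancel _
  have h2 := key _ h1 (by
      rw [map_mul, map_pow, map_inv, hpι, map_commutatorElement,
        commutatorElement_eq_one_iff_mul_comm.mpr (mul_comm _ _)]
      simp) (by
      rw [map_mul, map_pow, map_inv, hqι, map_commutatorElement,
        commutatorElement_eq_one_iff_mul_comm.mpr (mul_comm _ _)]
      simp)
  exact hrs ⟨g, (mul_inv_eq_one.mp h2).symm⟩

section ext0

variable (G : Type u) [Group G]

/-- The base group. -/
abbrev X0 : Type u := G × Multiplicative ℤ × Multiplicative ℤ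

/-- The fibre. -/
abbrev T0 : Type u := Additive (Abelianization G) × Additive (Abelianization G) × ℤ

/-- The cocycle. -/
def b0 : BiAdd (X0 G) (T0 G) where
  f p q := (p.2.1.toAdd • ab q.1, p.2.2.toAdd • ab q.1, p.2.1.toAdd * q.2.2.toAdd)
  mul_left a b c := by
    simp [add_smul, add_mul]
  mul_right a b c := by
    simp [ab_mul, smul_add, mul_add]

variable {G}

theorem ab_one : ab (1 : G) = 0 := rfl

theorem ab_inv (a : G) : ab a⁻¹ = - ab a := by simp [ab]

theorem X0_nil (hG : IsNil2 G) : IsNil2 (X0 G) := by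
  apply isNil2_of
  rintro ⟨a, q⟩ ⟨a', q'⟩ ⟨a₃, q₃⟩
  refine Prod.ext ?_ (mul_comm _ _)
  exact Subgroup.mem_center_iff.mp (hG (mem_comm a a')) a₃

/-- Relators. -/
def nel (hG : IsNil2 G) (x y : G) (n : ℕ) (g₁ g₂ : G) (a b c d : ℤ) : Tw (b0 G) :=
  ⟨((cm hG g₁ x * cm hG g₂ y : Subgroup.center G), 1),
    (n • ab g₁ - a • ab x - b • ab y, n • ab g₂ - c • ab y - d • ab x, n * (b - d))⟩

theorem nel_comm (hG : IsNil2 G) (x y : G) (n : ℕ) (g₁ g₂ : G) (a b c d : ℤ) :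
    (nel hG x y n g₁ g₂ a b c d).x ∈ commutator (X0 G) := by
  have : (cm hG g₁ x * cm hG g₂ y : G) ∈ commutator G :=
    mul_mem (mem_comm _ _) (mem_comm _ _)
  exact map_mem_comm (MonoidHom.inl G (Multiplicative ℤ × Multiplicative ℤ)) this

theorem nel_mul (hG : IsNil2 G) (x y : G) (n : ℕ) (g₁ g₂ : G) (a b c d : ℤ)
    (g₁' g₂' : G) (a' b' c' d' : ℤ) :
    nel hG x y n g₁ g₂ a b c d * nel hG x y n g₁' g₂' a' b' c' d' =
      nel hG x y n (g₁ * g₁') (g₂ * g₂') (a + a') (b + b') (c + c') (d + d') := by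
  refine Tw.ext ?_ ?_
  · refine Prod.ext ?_ (mul_one _)
    change ((cm hG g₁ x * cm hG g₂ y * (cm hG g₁' x * cm hG g₂' y) : Subgroup.center G) : G) = _
    rw [mul_mul_mul_comm]
    simp [nel]
  · rw [Tw.mul_t, (b0 G).comm_left (nel_comm _ _ _ _ _ _ _ _ _ _), add_zero]
    simp only [nel, ab_mul, Prod.mk_add_mk, Prod.mk.injEq]
    refine ⟨?_, ?_, ?_⟩
    · rw [add_smul, add_smul, smul_add]; abel
    · rw [add_smul, add_smul, smul_add]; abel
    · ring

theorem nel_one (hG : IsNil2 G) (x y : G) (n : ℕ) : nel hG x y n 1 1 0 0 0 0 = 1 := by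
  refine Tw.ext ?_ ?_
  · simp [nel]
  · simp [nel, ab_one]

/-- The subgroup of relators. -/
def N0 (hG : IsNil2 G) (x y : G) (n : ℕ) : Subgroup (Tw (b0 G)) where
  carrier := {e | ∃ g₁ g₂ a b c d, e = nel hG x y n g₁ g₂ a b c d}
  one_mem' := ⟨1, 1, 0, 0, 0, 0, (nel_one _ _ _ _).symm⟩
  mul_mem' := by
    rintro _ _ ⟨g₁, g₂, a, b, c, d, rfl⟩ ⟨g₁', g₂', a', b', c', d', rfl⟩
    exact ⟨_, _, _, _, _, _, nel_mul _ _ _ _ _ _ _ _ _ _ _ _ _ _ _ _⟩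
  inv_mem' := by
    rintro _ ⟨g₁, g₂, a, b, c, d, rfl⟩
    refine ⟨g₁⁻¹, g₂⁻¹, -a, -b, -c, -d, inv_eq_of_mul_eq_one_right ?_⟩
    rw [nel_mul]
    simp [nel_one]

theorem N0_normal (hG : IsNil2 G) (x y : G) (n : ℕ) : (N0 hG x y n).Normal := by
  apply normal_of_central
  rintro _ ⟨g₁, g₂, a, b, c, d, rfl⟩
  exact Subgroup.mem_center_iff.mpr (Tw.central (X0_nil hG) (nel_comm _ _ _ _ _ _ _ _ _ _))

/-- The embedding. -/
def i0 : G →* Tw (b0 G) := MonoidHom.mk' (fun g => ⟨(g, 1), 0⟩) (by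
  intro a b
  refine Tw.ext (Prod.ext rfl (mul_one _).symm) ?_
  have h : (b0 G).f (a, 1) (b, 1) = 0 := by simp [b0]
  rw [Tw.mul_t, h]; simp)

/-- The first new generator. -/
def r0 : Tw (b0 G) := ⟨(1, Multiplicative.ofAdd 1, 1), 0⟩

/-- The second new generator. -/
def s0 : Tw (b0 G) := ⟨(1, 1, Multiplicative.ofAdd 1), 0⟩

theorem pow_x (p : Tw (b0 G)) (n : ℕ) : (p ^ n).x = p.x ^ n := map_pow (Tw.proj) p n

theorem pow_fib (t : T0 G) (n : ℕ) : (⟨1, t⟩ : Tw (b0 G)) ^ n = ⟨1, n • t⟩ := by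
  induction n with
  | zero => simp; rfl
  | succ n ih =>
    rw [pow_succ, ih]
    refine Tw.ext ?_ ?_
    · simp
    · simp only [Tw.mul_t, (b0 G).one_left, add_zero, succ_nsmul]

theorem rs_comm (n : ℕ) : ⁅r0 (G := G), s0⁆ ^ n = (⟨1, (0, 0, n)⟩ : Tw (b0 G)) := by
  have : ⁅r0 (G := G), s0⁆ = (⟨1, (0, 0, 1)⟩ : Tw (b0 G)) := by
    rw [Tw.comm_t]
    refine Tw.ext ?_ ?_
    · exact commutatorElement_eq_one_iff_mul_comm.mpr (by simp [r0, s0])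
    · simp [b0, r0, s0, ab_one]
  rw [this, pow_fib]; simp

theorem r_central (hG : IsNil2 G) (x y : G) (n : ℕ) (h : Tw (b0 G)) :
    ⁅r0 ^ n * (i0 x)⁻¹, h⁆ ∈ N0 hG x y n := by
  obtain ⟨⟨g, i, j⟩, t⟩ := h
  refine ⟨g, 1, -i.toAdd, 0, 0, -j.toAdd, ?_⟩
  have hx : (r0 ^ n * (i0 x)⁻¹ : Tw (b0 G)).x = (x⁻¹, Multiplicative.ofAdd (n : ℤ), 1) := by
    rw [Tw.mul_x, pow_x, Tw.inv_x]
    simp [r0, i0, ← ofAdd_nsmul]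
  rw [Tw.comm_t, hx]
  refine Tw.ext ?_ ?_
  · refine Prod.ext ?_ (commutatorElement_eq_one_iff_mul_comm.mpr (mul_comm _ _))
    change ((cm hG x⁻¹ g : Subgroup.center G) : G) = (cm hG g x * cm hG 1 y : Subgroup.center G)
    rw [cm_swap hG x g]
    simp
  · simp [b0, nel, ab_one, ab_inv]

theorem s_central (hG : IsNil2 G) (x y : G) (n : ℕ) (h : Tw (b0 G)) :
    ⁅s0 ^ n * (i0 y)⁻¹, h⁆ ∈ N0 hG x y n := by
  obtain ⟨⟨g, i, j⟩, t⟩ := h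
  refine ⟨1, g, 0, -i.toAdd, -j.toAdd, 0, ?_⟩
  have hx : (s0 ^ n * (i0 y)⁻¹ : Tw (b0 G)).x = (y⁻¹, 1, Multiplicative.ofAdd (n : ℤ)) := by
    rw [Tw.mul_x, pow_x, Tw.inv_x]
    simp [s0, i0, ← ofAdd_nsmul]
  rw [Tw.comm_t, hx]
  refine Tw.ext ?_ ?_
  · refine Prod.ext ?_ (commutatorElement_eq_one_iff_mul_comm.mpr (mul_comm _ _))
    change ((cm hG y⁻¹ g : Subgroup.center G) : G) = (cm hG 1 x * cm hG g y : Subgroup.center G)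
    rw [cm_swap hG y g]
    simp
  · simp [b0, nel, ab_one, ab_inv, mul_comm]

theorem comm_of_ab (x y g : G) (n : ℕ) (a b : ℤ) (h : n • ab g - a • ab x - b • ab y = 0) :
    g ^ n * (x ^ a * y ^ b)⁻¹ ∈ commutator G := by
  apply mem_comm_of_ab
  have h' : n • ab g = a • ab x + b • ab y := by
    rwa [sub_sub, sub_eq_zero] at h
  rw [map_pow, map_mul, map_zpow, map_zpow]
  exact h'

theorem central_of {H : Type*} [Group H] (N : Subgroup H) [N.Normal] (z : H)
    (h : ∀ k, ⁅z, k⁆ ∈ N) : QuotientGroup.mk' N z ∈ Subgroup.center (H ⧸ N) := by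
  rw [Subgroup.mem_center_iff]
  intro k
  obtain ⟨k, rfl⟩ := QuotientGroup.mk'_surjective N k
  have : QuotientGroup.mk' N ⁅z, k⁆ = 1 := (QuotientGroup.eq_one_iff _).mpr (h k)
  rw [map_commutatorElement, commutatorElement_eq_one_iff_mul_comm] at this
  exact this.symm

theorem not_closed_of (hG : IsNil2 G) (x y : G) (n : ℕ) (hn : 0 < n) (h210 : ¬ Cond210 x y n)
    (h211 : ¬ Cond211 x y n) : ¬ IsAbsolutelyClosed G := by
  have hN := N0_normal hG x y n
  have hn' : (n : ℤ) ≠ 0 := by exact_mod_cast hn.ne'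
  let π := QuotientGroup.mk' (N0 hG x y n)
  let P : Tw (b0 G) →* Multiplicative ℤ :=
    (MonoidHom.fst _ _).comp ((MonoidHom.snd G (Multiplicative ℤ × Multiplicative ℤ)).comp Tw.proj)
  let Q : Tw (b0 G) →* Multiplicative ℤ :=
    (MonoidHom.snd _ _).comp ((MonoidHom.snd G (Multiplicative ℤ × Multiplicative ℤ)).comp Tw.proj)
  have hP : ∀ e ∈ N0 hG x y n, P e = 1 := by
    rintro _ ⟨g₁, g₂, a, b, c, d, rfl⟩; rfl
  have hQ : ∀ e ∈ N0 hG x y n, Q e = 1 := by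
    rintro _ ⟨g₁, g₂, a, b, c, d, rfl⟩; rfl
  refine not_closed (isNil2_surj (Tw.isNil2 (X0_nil hG)) π (QuotientGroup.mk'_surjective _))
    (π.comp i0) ?_ x y (π r0) (π s0) n hn ?_ ?_ (QuotientGroup.lift _ P hP)
    (QuotientGroup.lift _ Q hQ) (fun g => rfl) (fun g => rfl) rfl rfl rfl rfl ?_
  · rw [injective_iff_map_eq_one]
    intro g hg
    obtain ⟨g₁, g₂, a, b, c, d, he⟩ := (QuotientGroup.eq_one_iff _).mp hg
    by_contra hne
    have ht : (0 : T0 G) = (n • ab g₁ - a • ab x - b • ab y, n • ab g₂ - c • ab y - d • ab x,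
      n * (b - d)) := congrArg Tw.t he
    have hx : g = (cm hG g₁ x * cm hG g₂ y : Subgroup.center G) :=
      congrArg (fun e => e.x.1) he
    have t1 := (congrArg Prod.fst ht).symm
    have t2 := (congrArg (fun t => t.2.1) ht).symm
    have t3 := (congrArg (fun t => t.2.2) ht).symm
    simp only [Prod.fst_zero, Prod.snd_zero, mul_eq_zero, hn', false_or] at t1 t2 t3
    obtain rfl : b = d := by omega
    rw [sub_right_comm] at t2
    refine h210 ⟨a, b, c, g₁, g₂, comm_of_ab _ _ _ _ _ _ t1, comm_of_ab _ _ _ _ _ _ t2, ?_⟩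
    rw [cond_eq hG, cond_eq hG, ← Subgroup.coe_mul, ← hx]
    exact hne
  · have := central_of (N0 hG x y n) _ (r_central hG x y n)
    rwa [map_mul, map_pow, map_inv] at this
  · have := central_of (N0 hG x y n) _ (s_central hG x y n)
    rwa [map_mul, map_pow, map_inv] at this
  · rintro ⟨g, hg⟩
    rw [← map_commutatorElement, ← map_pow, rs_comm] at hg
    obtain ⟨g₁, g₂, a, b, c, d, he⟩ := QuotientGroup.eq.mp hg.symm
    have ht := congrArg Tw.t he
    simp only [Tw.mul_t, Tw.inv_t, Tw.inv_x, inv_one, (b0 G).one_left, add_zero] at ht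
    have ht' : -((0, 0, (n : ℤ)) : T0 G) + 0 = (n • ab g₁ - a • ab x - b • ab y,
      n • ab g₂ - c • ab y - d • ab x, n * (b - d)) := ht
    have t1 := (congrArg Prod.fst ht').symm
    have t2 := (congrArg (fun t => t.2.1) ht').symm
    have t3 := (congrArg (fun t => t.2.2) ht').symm
    simp only [Prod.neg_mk, neg_zero, add_zero] at t1 t2 t3
    obtain rfl : d = b + 1 := by
      have : (n : ℤ) * (d - (b + 1)) = 0 := by linear_combination -t3
      rcases mul_eq_zero.mp this with h | h
      · exact absurd h hn'
      · omega
    rw [sub_right_comm] at t2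
    exact h211 ⟨a, b, c, g₁, g₂, comm_of_ab _ _ _ _ _ _ t1, comm_of_ab _ _ _ _ _ _ t2⟩

end ext0

/-! ### The main theorem -/

theorem exists_mem_comm {G A : Type*} [Group G] [Group A] (ι : G →* A) (a : A)
    (h : a ∈ ι.range ⊔ commutator A) : ∃ x, a * (ι x)⁻¹ ∈ commutator A := by
  obtain ⟨_, ⟨x, rfl⟩, c, hc, rfl⟩ := Subgroup.mem_sup_of_normal_right.mp h
  refine ⟨x, ?_⟩
  exact Subgroup.Normal.conj_mem inferInstance c hc (ι x)

theorem root_pow {G : Type*} [Group G] (q : ℕ) (h : ∀ g : G, ∃ r : G, r ^ q = g) (α : ℕ) :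
    ∀ g : G, ∃ r : G, r ^ (q ^ α) = g := by
  induction α with
  | zero => intro g; exact ⟨g, by simp⟩
  | succ α ih =>
    intro g
    obtain ⟨r, rfl⟩ := h g
    obtain ⟨t, rfl⟩ := ih r
    exact ⟨t, by rw [pow_succ, pow_mul]⟩

/-- A `π`-divisible nil-2 group `G` is absolutely closed in `N₂` iff for all `x y ∈ G`,
every prime `q ∉ π` and every `α ≥ 1`, condition (2.10) or (2.11) holds with `n = q ^ α`. -/
theorem pi_divisible_absolutelyClosed_iff {G : Type u} [Group G] (hG : IsNil2 G)
    (π : Set ℕ) (hπ : ∀ p ∈ π, Nat.Prime p)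
    (hdiv : ∀ (g : G) (p : ℕ), p.Prime → p ∈ π → ∃ r : G, r ^ p = g) :
    IsAbsolutelyClosed G ↔
      ∀ (x y : G) (q : ℕ), q.Prime → q ∉ π → ∀ α : ℕ, 1 ≤ α →
        (Cond210 x y (q ^ α) ∨ Cond211 x y (q ^ α)) := by
  constructor
  · intro hcl x y q hq _ α _
    by_contra hno
    rw [not_or] at hno
    exact not_closed_of hG x y (q ^ α) (pow_pos hq.pos α) hno.1 hno.2 hcl
  · intro hc A _ hA ι hι
    apply closed_of ι.range hA
    apply mem_of_primePow hA
    intro r s q α hq hα hr hs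
    obtain ⟨x, hx⟩ := exists_mem_comm ι _ hr
    obtain ⟨y, hy⟩ := exists_mem_comm ι _ hs
    refine cond_mem hG hA ι hι x y r s _ hx hy ?_
    by_cases hqπ : q ∈ π
    · exact Or.inr (cond_of_div x y _ (root_pow q (fun g => hdiv g q hq hqπ) α x))
    · exact hc x y q hq hqπ α hα
end
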